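/- arXiv:math/0402319 — 3 statements merged into one kernel-verified Lean document; each statement's English description precedes it below -/
import Mathlib

section
/- For every integer n ≥ 1, every p ∈ ℂ∖{0}, and all α, β ∈ ℂ, the two-parameter family of twisted affinized Cremmer–Gervais matrices λ ↦ R_{CG(α,β)}(λ) ∈ End(ℂⁿ ⊗ ℂⁿ) satisfies the spectral-parameter Yang–Baxter equation: R₁₂(λ−λ′)R₁₃(λ)R₂₃(λ′) = R₂₃(λ′)R₁₃(λ)R₁₂(λ−λ′) in End(ℂⁿ ⊗ ℂⁿ ⊗ ℂⁿ) for all λ, λ′ ∈ ℂ, where R_{ij} denotes R_{CG(α,β)} acting in the i-th and j-th tensor factors. -/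
open Complex

/-- The untwisted entry `c_{ij}^{kl}` of the affinized Cremmer–Gervais matrix
(with `q = pⁿ` and `η = e^{πiλ}`). -/
noncomputable def cgCoeff {n : ℕ} (q η : ℂ) (i j k l : Fin n) : ℂ :=
  if i = j ∧ j = k ∧ k = l then q * η⁻¹ - q⁻¹ * η
  else if i = k ∧ j = l ∧ i ≠ j then
    -(η - η⁻¹) * (if (j : ℤ) < (i : ℤ) then q else q⁻¹)
  else if j = k ∧ i = l ∧ i ≠ j then
    (q - q⁻¹) * (if (i : ℤ) < (j : ℤ) then η else η⁻¹)
  else if (i : ℤ) + (j : ℤ) = (k : ℤ) + (l : ℤ) ∧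
      min (i : ℤ) (j : ℤ) < (k : ℤ) ∧ (k : ℤ) < max (i : ℤ) (j : ℤ) then
    (if (i : ℤ) < (j : ℤ) then 1 else -1) * (η - η⁻¹) * (q - q⁻¹)
  else 0

/-- The twisted affinized Cremmer–Gervais matrix `R_{CG(α,β)}(λ)`, written as a
matrix with row index `(k,l)` and column index `(i,j)`, so that
`R(e_i ⊗ e_j) = ∑ R_{ij}^{kl} e_k ⊗ e_l`. -/
noncomputable def RCGtwisted (n : ℕ) (p α β lam : ℂ) :
    Matrix (Fin n × Fin n) (Fin n × Fin n) ℂ := fun kl ij =>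
  Complex.exp (4 * (Real.pi : ℂ) * Complex.I * α * lam *
      (((ij.1 : ℤ) : ℂ) - ((kl.1 : ℤ) : ℂ))) *
  Complex.exp (4 * (Real.pi : ℂ) * Complex.I * β *
      (((ij.2 : ℤ) : ℂ) - ((kl.1 : ℤ) : ℂ))) *
  p ^ (2 * ((ij.2 : ℤ) - (kl.1 : ℤ))) *
  cgCoeff (p ^ n) (Complex.exp ((Real.pi : ℂ) * Complex.I * lam)) ij.1 ij.2 kl.1 kl.2

/-- `R₁₂ = R ⊗ id` as a matrix on the triple tensor product. -/
def mat12 {n : ℕ} (M : Matrix (Fin n × Fin n) (Fin n × Fin n) ℂ) :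
    Matrix (Fin n × Fin n × Fin n) (Fin n × Fin n × Fin n) ℂ := fun x y =>
  M (x.1, x.2.1) (y.1, y.2.1) * (if x.2.2 = y.2.2 then 1 else 0)

/-- `R₂₃ = id ⊗ R` as a matrix on the triple tensor product. -/
def mat23 {n : ℕ} (M : Matrix (Fin n × Fin n) (Fin n × Fin n) ℂ) :
    Matrix (Fin n × Fin n × Fin n) (Fin n × Fin n × Fin n) ℂ := fun x y =>
  (if x.1 = y.1 then 1 else 0) * M (x.2.1, x.2.2) (y.2.1, y.2.2)

/-- `R₁₃ = (id ⊗ P)(R ⊗ id)(id ⊗ P)` as a matrix on the triple tensor product. -/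
def mat13 {n : ℕ} (M : Matrix (Fin n × Fin n) (Fin n × Fin n) ℂ) :
    Matrix (Fin n × Fin n × Fin n) (Fin n × Fin n × Fin n) ℂ := fun x y =>
  M (x.1, x.2.2) (y.1, y.2.2) * (if x.2.1 = y.2.1 then 1 else 0)


/-- The untwisted matrix. -/
noncomputable def cgM (n : ℕ) (q η : ℂ) : Matrix (Fin n × Fin n) (Fin n × Fin n) ℂ :=
  fun kl ij => cgCoeff q η ij.1 ij.2 kl.1 kl.2

lemma geom_aux (x y : ℂ) (i d : ℕ) :
    (∑ m ∈ Finset.range d, x ^ (i + 1 + m) * y ^ (i + d - m)) * (y - x)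
      = x ^ (i + 1) * y ^ (i + 1 + d) - x ^ (i + 1 + d) * y ^ (i + 1) := by
  have h := (Commute.all x y).geom_sum₂_mul d
  have h2 : (∑ m ∈ Finset.range d, x ^ (i + 1 + m) * y ^ (i + d - m))
      = x ^ (i + 1) * y ^ (i + 1) * ∑ m ∈ Finset.range d, x ^ m * y ^ (d - 1 - m) := by
    rw [Finset.mul_sum]
    refine Finset.sum_congr rfl fun m hm => ?_
    have hm' := Finset.mem_range.1 hm
    rw [show i + d - m = (i + 1) + (d - 1 - m) by omega, pow_add, pow_add y]
    ring
  rw [h2, pow_add x, pow_add y]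
  rw [pow_add x (i + 1) d, pow_add y (i + 1) d]
  linear_combination (-(x ^ i * x ^ 1 * (y ^ i * y ^ 1))) * h

lemma strict_sum {n : ℕ} (x y : ℂ) (i j : Fin n) (h : i < j) :
    (∑ k : Fin n, ∑ l : Fin n, if (i : ℕ) + j = k + l ∧ i < k ∧ k < j
      then x ^ (k : ℕ) * y ^ (l : ℕ) else 0) * (y - x)
      = x ^ ((i : ℕ) + 1) * y ^ (j : ℕ) - x ^ (j : ℕ) * y ^ ((i : ℕ) + 1) := by
  obtain ⟨d, hd⟩ := Nat.exists_eq_add_of_lt (Fin.lt_def.1 h)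
  have h1 : ∀ k : Fin n, (∑ l : Fin n, if (i : ℕ) + j = k + l ∧ i < k ∧ k < j
      then x ^ (k : ℕ) * y ^ (l : ℕ) else 0)
      = (fun k : ℕ => if (i : ℕ) < k ∧ k < j then x ^ k * y ^ ((i : ℕ) + j - k) else 0) k := by
    intro k
    by_cases hk : i < k ∧ k < j
    · have hk1 := Fin.lt_def.1 hk.1
      have hk2 := Fin.lt_def.1 hk.2
      have hj := j.isLt
      rw [Finset.sum_eq_single (⟨(i : ℕ) + j - k, by omega⟩ : Fin n)]
      · dsimp only
        rw [if_pos ⟨by omega, hk⟩, if_pos ⟨hk1, hk2⟩]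
      · intro b _ hb
        rw [if_neg]
        rintro ⟨h3, _⟩
        apply hb
        ext
        simp only
        omega
      · simp
    · dsimp only
      rw [if_neg (show ¬((i : ℕ) < k ∧ (k : ℕ) < j) from hk)]
      apply Finset.sum_eq_zero
      intro l _
      rw [if_neg]
      tauto
  rw [Finset.sum_congr rfl fun k _ => h1 k,
    Fin.sum_univ_eq_sum_range (fun k : ℕ => if (i : ℕ) < k ∧ k < j then x ^ k * y ^ ((i : ℕ) + j - k) else 0)]
  rw [← Finset.sum_filter]
  have h2 : Finset.filter (fun k => (i : ℕ) < k ∧ k < j) (Finset.range n)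
      = Finset.Ico ((i : ℕ) + 1) (i + 1 + d) := by
    ext k
    have hj := j.isLt
    simp only [Finset.mem_filter, Finset.mem_range, Finset.mem_Ico]
    omega
  rw [h2, Finset.sum_Ico_eq_sum_range]
  have h3 := geom_aux x y i d
  rw [show (j : ℕ) = i + 1 + d by omega, ← h3]
  congr 1
  rw [show (i : ℕ) + 1 + d - (i + 1) = d by omega]
  refine Finset.sum_congr rfl fun m hm => ?_
  rw [show (i : ℕ) + (i + 1 + d) - (i + 1 + m) = i + d - m by omega]

lemma coeff_lt {n : ℕ} (q η : ℂ) (i j k l : Fin n) (h : i < j) :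
    cgCoeff q η i j k l =
      (if k = i then if l = j then -(η - η⁻¹) * q⁻¹ else 0 else 0)
      + (if k = j then if l = i then (q - q⁻¹) * η else 0 else 0)
      + (η - η⁻¹) * (q - q⁻¹) * (if (i : ℕ) + j = k + l ∧ i < k ∧ k < j then 1 else 0) := by
  unfold cgCoeff
  simp only [Fin.lt_def, Fin.ext_iff, ne_eq] at *
  split_ifs <;> first | omega | ring

lemma coeff_gt {n : ℕ} (q η : ℂ) (i j k l : Fin n) (h : j < i) :
    cgCoeff q η i j k l =
      (if k = i then if l = j then -(η - η⁻¹) * q else 0 else 0)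
      + (if k = j then if l = i then (q - q⁻¹) * η⁻¹ else 0 else 0)
      - (η - η⁻¹) * (q - q⁻¹) * (if (j : ℕ) + i = k + l ∧ j < k ∧ k < i then 1 else 0) := by
  unfold cgCoeff
  simp only [Fin.lt_def, Fin.ext_iff, ne_eq] at *
  split_ifs <;> first | omega | ring

lemma coeff_eq {n : ℕ} (q η : ℂ) (i k l : Fin n) :
    cgCoeff q η i i k l =
      (if k = i then if l = i then q * η⁻¹ - q⁻¹ * η else 0 else 0) := by
  unfold cgCoeff
  simp only [Fin.ext_iff, ne_eq, true_and, not_true_eq_false, and_false, if_false] at *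
  split_ifs <;> first | omega | ring

lemma coeff_cons {n : ℕ} (q η : ℂ) (i j k l : Fin n) (h : cgCoeff q η i j k l ≠ 0) :
    (i : ℕ) + j = k + l := by
  by_contra h'
  apply h
  unfold cgCoeff
  simp only [Fin.ext_iff, ne_eq] at *
  split_ifs <;> first | omega | rfl

noncomputable def cA (q η x y : ℂ) : ℂ := (η - η⁻¹) * (q * x - q⁻¹ * y) / (y - x)
noncomputable def cB (q η x y : ℂ) : ℂ := (q - q⁻¹) * (η⁻¹ * y - η * x) / (y - x)

lemma key {n : ℕ} (q η x y : ℂ) (hxy : x ≠ y) (i j : Fin n) :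
    ∑ k : Fin n, ∑ l : Fin n, x ^ (k : ℕ) * y ^ (l : ℕ) * cgCoeff q η i j k l
      = cA q η x y * (x ^ (i : ℕ) * y ^ (j : ℕ)) + cB q η x y * (y ^ (i : ℕ) * x ^ (j : ℕ)) := by
  have hyx : y - x ≠ 0 := sub_ne_zero.2 hxy.symm
  rcases lt_trichotomy i j with h | h | h
  · have hs := strict_sum x y i j h
    have : ∑ k : Fin n, ∑ l : Fin n, x ^ (k : ℕ) * y ^ (l : ℕ) * cgCoeff q η i j k l
      = x ^ (i : ℕ) * y ^ (j : ℕ) * (-(η - η⁻¹) * q⁻¹) + x ^ (j : ℕ) * y ^ (i : ℕ) * ((q - q⁻¹) * η)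
        + (η - η⁻¹) * (q - q⁻¹) * (∑ k : Fin n, ∑ l : Fin n, if (i : ℕ) + j = k + l ∧ i < k ∧ k < j
      then x ^ (k : ℕ) * y ^ (l : ℕ) else 0) := by
      simp only [coeff_lt q η i j _ _ h, mul_add, Finset.sum_add_distrib, Finset.mul_sum]
      congr 1
      · congr 1
        · simp [-neg_sub, -mul_neg, -neg_mul]
        · simp
      · refine Finset.sum_congr rfl fun k _ => Finset.sum_congr rfl fun l _ => ?_
        split_ifs <;> ring
    rw [this]
    unfold cA cB
    rw [div_mul_eq_mul_div, div_mul_eq_mul_div, ← add_div, eq_div_iff hyx, add_mul _ _ (y - x), mul_assoc _ _ (y - x), hs]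
    ring
  · subst h
    simp only [coeff_eq]
    unfold cA cB
    rw [div_mul_eq_mul_div, div_mul_eq_mul_div, ← add_div, eq_div_iff hyx]
    simp
    ring
  · have hs := strict_sum x y j i h
    have : ∑ k : Fin n, ∑ l : Fin n, x ^ (k : ℕ) * y ^ (l : ℕ) * cgCoeff q η i j k l
      = x ^ (i : ℕ) * y ^ (j : ℕ) * (-(η - η⁻¹) * q) + x ^ (j : ℕ) * y ^ (i : ℕ) * ((q - q⁻¹) * η⁻¹)
        - (η - η⁻¹) * (q - q⁻¹) * (∑ k : Fin n, ∑ l : Fin n, if (j : ℕ) + i = k + l ∧ j < k ∧ k < i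
      then x ^ (k : ℕ) * y ^ (l : ℕ) else 0) := by
      simp only [coeff_gt q η i j _ _ h, mul_add, mul_sub (_ * _) (_ + _), Finset.sum_sub_distrib, Finset.sum_add_distrib, Finset.mul_sum]
      congr 1
      · congr 1
        · simp [-neg_sub, -mul_neg, -neg_mul]
        · simp
      · refine Finset.sum_congr rfl fun k _ => Finset.sum_congr rfl fun l _ => ?_
        split_ifs <;> ring
    rw [this]
    unfold cA cB
    rw [div_mul_eq_mul_div, div_mul_eq_mul_div, ← add_div, eq_div_iff hyx, sub_mul _ _ (y - x), mul_assoc _ _ (y - x), hs]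
    ring

/-- Monomial row vector. -/
def vv (n : ℕ) (x y z : ℂ) : Fin n × Fin n × Fin n → ℂ :=
  fun a => x ^ (a.1 : ℕ) * y ^ (a.2.1 : ℕ) * z ^ (a.2.2 : ℕ)

open Matrix

lemma vv12 (n : ℕ) (q η x y z : ℂ) (h : x ≠ y) :
    vv n x y z ᵥ* mat12 (cgM n q η) = cA q η x y • vv n x y z + cB q η x y • vv n y x z := by
  funext ⟨i, j, m⟩
  have hk := key q η x y h i j
  simp only [vecMul, dotProduct, vv, mat12, cgM, Fintype.sum_prod_type, Pi.add_apply, Pi.smul_apply,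
    smul_eq_mul, mul_ite, mul_one, mul_zero, Finset.sum_ite_eq', Finset.mem_univ, if_true]
  trans (∑ k : Fin n, ∑ l : Fin n, x ^ (k : ℕ) * y ^ (l : ℕ) * cgCoeff q η i j k l) * z ^ (m : ℕ)
  · simp only [Finset.sum_mul]
    refine Finset.sum_congr rfl fun k _ => Finset.sum_congr rfl fun l _ => ?_
    ring
  · rw [hk]; ring

lemma vv13 (n : ℕ) (q η x y z : ℂ) (h : x ≠ z) :
    vv n x y z ᵥ* mat13 (cgM n q η) = cA q η x z • vv n x y z + cB q η x z • vv n z y x := by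
  funext ⟨i, m, j⟩
  have hk := key q η x z h i j
  simp only [vecMul, dotProduct, vv, mat13, cgM, Fintype.sum_prod_type, Pi.add_apply, Pi.smul_apply,
    smul_eq_mul, mul_ite, mul_one, mul_zero]
  trans (∑ k : Fin n, ∑ l : Fin n, x ^ (k : ℕ) * z ^ (l : ℕ) * cgCoeff q η i j k l) * y ^ (m : ℕ)
  · simp only [Finset.sum_mul]
    refine Finset.sum_congr rfl fun k _ => ?_
    rw [Finset.sum_comm]
    refine Finset.sum_congr rfl fun l _ => ?_
    simp only [Finset.sum_ite_eq', Finset.mem_univ, if_true]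
    ring
  · rw [hk]; ring

lemma vv23 (n : ℕ) (q η x y z : ℂ) (h : y ≠ z) :
    vv n x y z ᵥ* mat23 (cgM n q η) = cA q η y z • vv n x y z + cB q η y z • vv n x z y := by
  funext ⟨m, i, j⟩
  have hk := key q η y z h i j
  simp only [vecMul, dotProduct, vv, mat23, cgM, Fintype.sum_prod_type, Pi.add_apply, Pi.smul_apply,
    smul_eq_mul, ite_mul, mul_ite, one_mul, zero_mul, mul_zero]
  trans (∑ k : Fin n, ∑ l : Fin n, y ^ (k : ℕ) * z ^ (l : ℕ) * cgCoeff q η i j k l) * x ^ (m : ℕ)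
  · rw [Finset.sum_eq_single m]
    · simp only [if_true, Finset.sum_mul]
      refine Finset.sum_congr rfl fun k _ => Finset.sum_congr rfl fun l _ => ?_
      ring
    · intro b _ hb
      simp [hb]
    · simp
  · rw [hk]; ring

lemma poly_zero {n : ℕ} (g : Fin n → ℂ) (S : Finset ℂ)
    (h : ∀ x, x ∉ S → ∑ k : Fin n, x ^ (k : ℕ) * g k = 0) (k : Fin n) : g k = 0 := by
  let P : Polynomial ℂ := ∑ k : Fin n, Polynomial.monomial (k : ℕ) (g k)
  have hP : P = 0 := by
    refine Polynomial.eq_zero_of_infinite_isRoot P ?_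
    refine (S.finite_toSet.infinite_compl).mono fun x hx => ?_
    have := h x (by simpa using hx)
    simp only [Set.mem_ofPred_eq, Polynomial.IsRoot, P, Polynomial.eval_finsetSum, Polynomial.eval_monomial]
    rw [← this]
    exact Finset.sum_congr rfl fun k _ => mul_comm _ _
  have h2 : P.coeff k = g k := by
    simp only [P, Polynomial.finsetSum_coeff, Polynomial.coeff_monomial]
    simp [← Fin.ext_iff]
  rw [← h2, hP]; simp

lemma vv_zero {n : ℕ} (g : Fin n × Fin n × Fin n → ℂ)
    (h : ∀ x y z : ℂ, x ≠ y → x ≠ z → y ≠ z → ∑ a, vv n x y z a * g a = 0) : g = 0 := by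
  funext ⟨k, l, m⟩
  have hz : ∀ z : ℂ, z ∉ (∅ : Finset ℂ) → ∑ m : Fin n, z ^ (m : ℕ) * g (k, l, m) = 0 := by
    intro z _
    refine poly_zero (fun l : Fin n => ∑ m : Fin n, z ^ (m : ℕ) * g (k, l, m)) {z} ?_ l
    intro y hy
    refine poly_zero (fun k : Fin n => ∑ l : Fin n, y ^ (l : ℕ) * ∑ m : Fin n, z ^ (m : ℕ) * g (k, l, m)) {y, z} ?_ k
    intro x hx
    simp only [Finset.mem_singleton, Finset.mem_insert, not_or] at hx hy
    rw [← h x y z hx.1 hx.2 hy]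
    simp only [Fintype.sum_prod_type, vv, Finset.mul_sum]
    refine Finset.sum_congr rfl fun k _ => Finset.sum_congr rfl fun l _ =>
      Finset.sum_congr rfl fun m _ => ?_
    ring
  exact poly_zero (fun m : Fin n => g (k, l, m)) ∅ hz m

lemma mat_eq {n : ℕ} (A B : Matrix (Fin n × Fin n × Fin n) (Fin n × Fin n × Fin n) ℂ)
    (h : ∀ x y z : ℂ, x ≠ y → x ≠ z → y ≠ z → vv n x y z ᵥ* A = vv n x y z ᵥ* B) : A = B := by
  ext a b
  have := vv_zero (fun a => A a b - B a b) (by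
    intro x y z h1 h2 h3
    have := congrFun (h x y z h1 h2 h3) b
    simp only [vecMul, dotProduct] at this
    simp only [mul_sub, Finset.sum_sub_distrib, this, sub_self])
  exact sub_eq_zero.1 (congrFun this a)

lemma cg_ybe (n : ℕ) (q η μ : ℂ) (hq : q ≠ 0) (hη : η ≠ 0) (hμ : μ ≠ 0) :
    mat12 (cgM n q (η / μ)) * mat13 (cgM n q η) * mat23 (cgM n q μ)
      = mat23 (cgM n q μ) * mat13 (cgM n q η) * mat12 (cgM n q (η / μ)) := by
  apply mat_eq
  intro x y z hxy hxz hyz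
  simp only [← vecMul_vecMul]
  simp only [vv12 _ _ _ _ _ _ hxy, vv12 _ _ _ _ _ _ hxz, vv12 _ _ _ _ _ _ hyz,
    vv12 _ _ _ _ _ _ hxy.symm, vv12 _ _ _ _ _ _ hxz.symm, vv12 _ _ _ _ _ _ hyz.symm,
    vv13 _ _ _ _ _ _ hxy, vv13 _ _ _ _ _ _ hxz, vv13 _ _ _ _ _ _ hyz,
    vv13 _ _ _ _ _ _ hxy.symm, vv13 _ _ _ _ _ _ hxz.symm, vv13 _ _ _ _ _ _ hyz.symm,
    vv23 _ _ _ _ _ _ hxy, vv23 _ _ _ _ _ _ hxz, vv23 _ _ _ _ _ _ hyz,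
    vv23 _ _ _ _ _ _ hxy.symm, vv23 _ _ _ _ _ _ hxz.symm, vv23 _ _ _ _ _ _ hyz.symm,
    add_vecMul, smul_vecMul]
  have h1 : x - y ≠ 0 := sub_ne_zero.2 hxy
  have h2 : x - z ≠ 0 := sub_ne_zero.2 hxz
  have h3 : y - z ≠ 0 := sub_ne_zero.2 hyz
  have h1' : y - x ≠ 0 := sub_ne_zero.2 hxy.symm
  have h2' : z - x ≠ 0 := sub_ne_zero.2 hxz.symm
  have h3' : z - y ≠ 0 := sub_ne_zero.2 hyz.symm
  have e1 : y - x = -(x - y) := by ring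
  have e2 : z - x = -(x - z) := by ring
  have e3 : z - y = -(y - z) := by ring
  match_scalars
  all_goals
    simp only [cA, cB, e1, e2, e3, mul_one]
    field_simp
    try ring

/-- Weighted exponential. -/
noncomputable def wt (n : ℕ) (a b c : ℂ) : Fin n × Fin n × Fin n → ℂ :=
  fun x => Complex.exp (a * ((x.1 : ℕ) : ℂ) + b * ((x.2.1 : ℕ) : ℂ) + c * ((x.2.2 : ℕ) : ℂ))

lemma wt_mul (n : ℕ) (a b c : ℂ) : diagonal (wt n a b c) * diagonal (wt n (-a) (-b) (-c)) = 1 := by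
  rw [diagonal_mul_diagonal, ← diagonal_one]
  congr 1
  funext x
  simp only [wt, ← Complex.exp_add]
  rw [← Complex.exp_zero]
  congr 1
  ring

lemma tw_entry (n : ℕ) (p : ℂ) (hp : p ≠ 0) (α β lam : ℂ) (kl ij : Fin n × Fin n) :
    RCGtwisted n p α β lam kl ij =
      Complex.exp (4 * (Real.pi : ℂ) * Complex.I * α * lam * (((ij.1 : ℕ) : ℂ) - ((kl.1 : ℕ) : ℂ))
       + (4 * (Real.pi : ℂ) * Complex.I * β + 2 * Complex.log p) * (((ij.2 : ℕ) : ℂ) - ((kl.1 : ℕ) : ℂ)))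
      * cgM n (p ^ n) (Complex.exp ((Real.pi : ℂ) * Complex.I * lam)) kl ij := by
  have h : p ^ (2 * ((ij.2 : ℤ) - (kl.1 : ℤ))) =
      Complex.exp (2 * Complex.log p * (((ij.2 : ℕ) : ℂ) - ((kl.1 : ℕ) : ℂ))) := by
    conv_lhs => rw [← Complex.exp_log hp, ← Complex.exp_int_mul]
    congr 1
    push_cast
    ring
  unfold RCGtwisted cgM
  rw [h, ← Complex.exp_add, ← Complex.exp_add]
  congr 2
  push_cast
  ring

lemma tw12 (n : ℕ) (p : ℂ) (hp : p ≠ 0) (α β lam a b c a' b' c' u t : ℂ)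
    (hu : u = 4 * (Real.pi : ℂ) * Complex.I * α * lam)
    (ht : t = 4 * (Real.pi : ℂ) * Complex.I * β + 2 * Complex.log p)
    (h1 : c' = c) (h2 : a' - b' = u - t) (h3 : a - b = u + t) (h4 : b' = b + t) :
    mat12 (RCGtwisted n p α β lam) = diagonal (wt n (-a) (-b) (-c)) *
      mat12 (cgM n (p ^ n) (Complex.exp ((Real.pi : ℂ) * Complex.I * lam))) *
      diagonal (wt n a' b' c') := by
  ext ⟨k, l, m⟩ ⟨i, j, m'⟩
  rw [mul_diagonal, diagonal_mul]
  simp only [mat12, tw_entry n p hp, ← hu, ← ht]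
  by_cases hm : m = m'
  · subst hm
    by_cases h0 : cgM n (p ^ n) (Complex.exp ((Real.pi : ℂ) * Complex.I * lam)) (k, l) (i, j) = 0
    · simp [h0]
    have hc := coeff_cons _ _ _ _ _ _ h0
    have hc' : ((i : ℕ) : ℂ) + ((j : ℕ) : ℂ) = ((k : ℕ) : ℂ) + ((l : ℕ) : ℂ) := by
      exact_mod_cast hc
    simp only [if_true, mul_one, wt]
    rw [mul_right_comm (Complex.exp _), ← Complex.exp_add]
    congr 2
    linear_combination (-((m : ℕ) : ℂ)) * h1 - ((i : ℕ) : ℂ) * h2 + ((k : ℕ) : ℂ) * h3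
      - (((i : ℕ) : ℂ) + ((j : ℕ) : ℂ)) * h4 - b * hc'
  · simp [hm]

lemma tw13 (n : ℕ) (p : ℂ) (hp : p ≠ 0) (α β lam a b c a' b' c' u t : ℂ)
    (hu : u = 4 * (Real.pi : ℂ) * Complex.I * α * lam)
    (ht : t = 4 * (Real.pi : ℂ) * Complex.I * β + 2 * Complex.log p)
    (h1 : c' = c) (h2 : a' - b' = u - t) (h3 : a - b = u + t) (h4 : b' = b + t) :
    mat13 (RCGtwisted n p α β lam) = diagonal (wt n (-a) (-c) (-b)) *
      mat13 (cgM n (p ^ n) (Complex.exp ((Real.pi : ℂ) * Complex.I * lam))) *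
      diagonal (wt n a' c' b') := by
  ext ⟨k, m, l⟩ ⟨i, m', j⟩
  rw [mul_diagonal, diagonal_mul]
  simp only [mat13, tw_entry n p hp, ← hu, ← ht]
  by_cases hm : m = m'
  · subst hm
    by_cases h0 : cgM n (p ^ n) (Complex.exp ((Real.pi : ℂ) * Complex.I * lam)) (k, l) (i, j) = 0
    · simp [h0]
    have hc := coeff_cons _ _ _ _ _ _ h0
    have hc' : ((i : ℕ) : ℂ) + ((j : ℕ) : ℂ) = ((k : ℕ) : ℂ) + ((l : ℕ) : ℂ) := by
      exact_mod_cast hc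
    simp only [if_true, mul_one, wt]
    rw [mul_right_comm (Complex.exp _), ← Complex.exp_add]
    congr 2
    linear_combination (-((m : ℕ) : ℂ)) * h1 - ((i : ℕ) : ℂ) * h2 + ((k : ℕ) : ℂ) * h3
      - (((i : ℕ) : ℂ) + ((j : ℕ) : ℂ)) * h4 - b * hc'
  · simp [hm]

lemma tw23 (n : ℕ) (p : ℂ) (hp : p ≠ 0) (α β lam a b c a' b' c' u t : ℂ)
    (hu : u = 4 * (Real.pi : ℂ) * Complex.I * α * lam)
    (ht : t = 4 * (Real.pi : ℂ) * Complex.I * β + 2 * Complex.log p)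
    (h1 : c' = c) (h2 : a' - b' = u - t) (h3 : a - b = u + t) (h4 : b' = b + t) :
    mat23 (RCGtwisted n p α β lam) = diagonal (wt n (-c) (-a) (-b)) *
      mat23 (cgM n (p ^ n) (Complex.exp ((Real.pi : ℂ) * Complex.I * lam))) *
      diagonal (wt n c' a' b') := by
  ext ⟨m, k, l⟩ ⟨m', i, j⟩
  rw [mul_diagonal, diagonal_mul]
  simp only [mat23, tw_entry n p hp, ← hu, ← ht]
  by_cases hm : m = m'
  · subst hm
    by_cases h0 : cgM n (p ^ n) (Complex.exp ((Real.pi : ℂ) * Complex.I * lam)) (k, l) (i, j) = 0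
    · simp [h0]
    have hc := coeff_cons _ _ _ _ _ _ h0
    have hc' : ((i : ℕ) : ℂ) + ((j : ℕ) : ℂ) = ((k : ℕ) : ℂ) + ((l : ℕ) : ℂ) := by
      exact_mod_cast hc
    simp only [if_true, one_mul, wt]
    rw [mul_right_comm (Complex.exp _), ← Complex.exp_add]
    congr 2
    linear_combination (-((m : ℕ) : ℂ)) * h1 - ((i : ℕ) : ℂ) * h2 + ((k : ℕ) : ℂ) * h3
      - (((i : ℕ) : ℂ) + ((j : ℕ) : ℂ)) * h4 - b * hc'
  · simp [hm]

lemma telescope {ι : Type*} [Fintype ι] [DecidableEq ι] (D1 A D2 D2' B D3 D3' C D4 : Matrix ι ι ℂ)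
    (h2 : D2 * D2' = 1) (h3 : D3 * D3' = 1) :
    (D1 * A * D2) * (D2' * B * D3) * (D3' * C * D4) = D1 * (A * B * C) * D4 := by
  calc _ = D1 * A * (D2 * D2') * B * (D3 * D3') * C * D4 := by simp only [Matrix.mul_assoc]
    _ = _ := by rw [h2, h3]; simp only [Matrix.mul_assoc, Matrix.one_mul]

/-- The two-parameter family of twisted affinized Cremmer–Gervais matrices
satisfies the spectral-parameter Yang–Baxter equation. -/
theorem RCGtwisted_yang_baxter (n : ℕ) (hn : 1 ≤ n) (p : ℂ) (hp : p ≠ 0)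
    (α β : ℂ) (lam lam' : ℂ) :
    mat12 (RCGtwisted n p α β (lam - lam')) * mat13 (RCGtwisted n p α β lam) *
        mat23 (RCGtwisted n p α β lam') =
      mat23 (RCGtwisted n p α β lam') * mat13 (RCGtwisted n p α β lam) *
        mat12 (RCGtwisted n p α β (lam - lam')) := by
  obtain ⟨t, ht⟩ : ∃ t, t = 4 * (Real.pi : ℂ) * Complex.I * β + 2 * Complex.log p := ⟨_, rfl⟩
  obtain ⟨u, hu⟩ : ∃ u, u = 4 * (Real.pi : ℂ) * Complex.I * α * lam := ⟨_, rfl⟩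
  obtain ⟨v, hv⟩ : ∃ v, v = 4 * (Real.pi : ℂ) * Complex.I * α * lam' := ⟨_, rfl⟩
  have huv : u - v = 4 * (Real.pi : ℂ) * Complex.I * α * (lam - lam') := by rw [hu, hv]; ring
  have hy := cg_ybe n (p ^ n) (Complex.exp ((Real.pi : ℂ) * Complex.I * lam))
    (Complex.exp ((Real.pi : ℂ) * Complex.I * lam')) (pow_ne_zero _ hp) (Complex.exp_ne_zero _)
    (Complex.exp_ne_zero _)
  rw [← Complex.exp_sub, ← mul_sub] at hy
  conv_lhs =>
    rw [tw12 n p hp α β (lam - lam') (u + 2 * t) (v + t) 0 (u + t) (v + 2 * t) 0 (u - v) t huv ht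
        (by ring) (by ring) (by ring) (by ring),
      tw13 n p hp α β lam (u + t) 0 (v + 2 * t) u t (v + 2 * t) u t hu ht
        (by ring) (by ring) (by ring) (by ring),
      tw23 n p hp α β lam' (v + 2 * t) t u (v + t) (2 * t) u v t hv ht
        (by ring) (by ring) (by ring) (by ring),
      telescope _ _ _ _ _ _ _ _ _ (wt_mul _ _ _ _) (wt_mul _ _ _ _), hy]
  conv_rhs =>
    rw [tw23 n p hp α β lam' (v + t) 0 (u + 2 * t) v t (u + 2 * t) v t hv ht
        (by ring) (by ring) (by ring) (by ring),
      tw13 n p hp α β lam (u + 2 * t) t v (u + t) (2 * t) v u t hu ht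
        (by ring) (by ring) (by ring) (by ring),
      tw12 n p hp α β (lam - lam') (u + t) v (2 * t) u (v + t) (2 * t) (u - v) t huv ht
        (by ring) (by ring) (by ring) (by ring),
      telescope _ _ _ _ _ _ _ _ _ (wt_mul _ _ _ _) (wt_mul _ _ _ _)]
end

section
/- Let n ≥ 1 be an integer, τ ∈ ℂ with Im τ > 0, and λ, κ ∈ ℂ with ϑ₁(κ,τ) ≠ 0. Let F : ℂ × ℂ → ℂ be holomorphic (jointly analytic) with F(·,z₂) ∈ V^e_n for every z₂ ∈ ℂ and F(z₁,·) ∈ V^e_n for every z₁ ∈ ℂ. Then there exists a holomorphic function G : ℂ × ℂ → ℂ with G(·,z₂) ∈ V^e_n for every z₂ and G(z₁,·) ∈ V^e_n for every z₁, such that G(z₁,z₂) = (𝓡_λ F)(z₁,z₂) for all (z₁,z₂) with ϑ₁(z₁−z₂−(λ+κ)/n, τ) ≠ 0. (That is, the twisted elliptic Shibukawa–Ueno operator preserves V^e_n ⊗ V^e_n, the singularities along ϑ₁(u,τ) = 0 being removable.) -/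
open Complex

/-- Jacobi's first theta function
`ϑ₁(z,τ) = −∑_{m∈ℤ} exp(πi(m+1/2)²τ + 2πi(m+1/2)(z+1/2))` (here `theta1 τ z = ϑ₁(z,τ)`). -/
noncomputable def theta1 (τ z : ℂ) : ℂ :=
  -∑' m : ℤ, Complex.exp ((Real.pi : ℂ) * Complex.I * ((m : ℂ) + 1 / 2) ^ 2 * τ +
    2 * (Real.pi : ℂ) * Complex.I * ((m : ℂ) + 1 / 2) * (z + 1 / 2))

/-- The twisted elliptic Shibukawa–Ueno operator `𝓡_λ` (with parameters `n`, `τ`, `λ`, `κ`),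
applied to a function `F : ℂ² → ℂ` and evaluated at `(z₁, z₂)`:
`(𝓡_λF)(z₁,z₂) = [ϑ₁′(0)ϑ₁(u+λ)/ϑ₁(u)]·F(z₂+λ/n, z₁−λ/n)
  − [ϑ₁(λ)ϑ₁′(0)ϑ₁(u+κ)/(ϑ₁(u)ϑ₁(κ))]·F(z₁−κ/n, z₂+κ/n)`, `u = z₁−z₂−(λ+κ)/n`. -/
noncomputable def RopE (n : ℕ) (τ lam κ : ℂ) (F : ℂ × ℂ → ℂ) (z₁ z₂ : ℂ) : ℂ :=
  deriv (theta1 τ) 0 * theta1 τ ((z₁ - z₂ - (lam + κ) / (n : ℂ)) + lam) /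
      theta1 τ (z₁ - z₂ - (lam + κ) / (n : ℂ)) *
    F (z₂ + lam / (n : ℂ), z₁ - lam / (n : ℂ)) -
  theta1 τ lam * deriv (theta1 τ) 0 * theta1 τ ((z₁ - z₂ - (lam + κ) / (n : ℂ)) + κ) /
      (theta1 τ (z₁ - z₂ - (lam + κ) / (n : ℂ)) * theta1 τ κ) *
    F (z₁ - κ / (n : ℂ), z₂ + κ / (n : ℂ))

/-- Membership in `V^e_n`: entire functions with the two quasi-periodicity
properties `f(z+1) = (−1)^{n−1} f(z)` and `f(z+τ) = e^{−πinτ−2πinz} f(z)`. -/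
def MemVe (n : ℕ) (τ : ℂ) (f : ℂ → ℂ) : Prop :=
  Differentiable ℂ f ∧
  (∀ z : ℂ, f (z + 1) = (-1) ^ (n - 1) * f z) ∧
  (∀ z : ℂ, f (z + τ) =
    Complex.exp (-(Real.pi : ℂ) * Complex.I * (n : ℂ) * τ -
      2 * (Real.pi : ℂ) * Complex.I * (n : ℂ) * z) * f z)


lemma aux_paramInt (H : ℂ × ℂ → ℂ) (hH : Differentiable ℂ H) (a w₀ : ℂ) :
    DifferentiableAt ℂ (fun x : ℂ × ℂ => ∮ ζ in C(a, 1), (ζ - x.1)⁻¹ • ((ζ - a)⁻¹ * H (ζ, x.2)))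
      (a, w₀) := by
  set c : ℝ → ℂ := circleMap a 1 with hc
  have hcc : Continuous c := continuous_circleMap a 1
  have hca : ∀ t, ‖c t - a‖ = 1 := fun t => by simp [hc, circleMap]
  have hA : ∀ t, ‖deriv c t‖ = 1 := fun t => by simp [hc, circleMap]
  have hAc : Continuous (deriv c) := by
    have : deriv c = fun t => circleMap 0 1 t * I := by ext t; simp [hc]
    rw [this]; fun_prop
  set x₀ : ℂ × ℂ := (a, w₀) with hx₀
  -- bound on H
  obtain ⟨M, hM⟩ := ((isCompact_closedBall x₀ 1).image hH.continuous).isBounded.exists_norm_le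
  have hM' : ∀ t, ∀ x ∈ Metric.ball x₀ (1/2), ‖H (c t, x.2)‖ ≤ M := by
    intro t x hx
    refine hM _ ⟨(c t, x.2), ?_, rfl⟩
    rw [Metric.mem_ball, Prod.dist_eq, max_lt_iff] at hx
    rw [Metric.mem_closedBall, Prod.dist_eq, max_le_iff]
    refine ⟨?_, by linarith [hx.2]⟩
    simp [hx₀, dist_eq_norm, hca]
  have hlow : ∀ t, ∀ x ∈ Metric.ball x₀ (1/2), 1/2 ≤ ‖c t - x.1‖ := by
    intro t x hx
    rw [Metric.mem_ball, Prod.dist_eq, max_lt_iff] at hx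
    have h1 : ‖x.1 - a‖ < 1/2 := by simpa [hx₀, dist_eq_norm] using hx.1
    have h2 : ‖c t - a‖ ≤ ‖c t - x.1‖ + ‖x.1 - a‖ := norm_sub_le_norm_sub_add_norm_sub _ _ _
    rw [hca] at h2; linarith
  have hne : ∀ t, ∀ x ∈ Metric.ball x₀ (1/2), c t - x.1 ≠ 0 := by
    intro t x hx h
    have := hlow t x hx
    rw [h] at this; norm_num at this
  set F : ℂ × ℂ → ℝ → ℂ := fun x t => deriv c t * ((c t - x.1)⁻¹ * ((c t - a)⁻¹ * H (c t, x.2)))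
    with hFdef
  have hFb : ∀ t, ∀ x ∈ Metric.ball x₀ (1/2), ‖F x t‖ ≤ 2 * M := by
    intro t x hx
    have h1 := hlow t x hx
    have h2 := hM' t x hx
    simp only [hFdef, norm_mul, norm_inv, hA, hca, inv_one, one_mul]
    have h3 : ‖c t - x.1‖⁻¹ ≤ 2 := by
      rw [inv_le_comm₀ (by linarith) (by norm_num)]; linarith
    exact mul_le_mul h3 h2 (norm_nonneg _) (by norm_num)
  have hM0 : 0 ≤ M := le_trans (norm_nonneg _) (hM' 0 x₀ (Metric.mem_ball_self (by norm_num)))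
  have hFd : ∀ t, ∀ x ∈ Metric.ball x₀ (1/2), HasFDerivAt (fun x => F x t)
      ((deriv c t) • (((c t - x.1)⁻¹ * (c t - a)⁻¹) •
        ((fderiv ℂ H (c t, x.2)).comp (ContinuousLinearMap.inr ℂ ℂ ℂ)).comp
          (ContinuousLinearMap.snd ℂ ℂ ℂ) +
        ((c t - a)⁻¹ * H (c t, x.2) * ((c t - x.1)^2)⁻¹) • ContinuousLinearMap.fst ℂ ℂ ℂ)) x := by
    intro t x hx
    have h0 := hne t x hx
    have h1 : HasFDerivAt (fun x : ℂ × ℂ => H (c t, x.2))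
      (((fderiv ℂ H (c t, x.2)).comp (ContinuousLinearMap.inr ℂ ℂ ℂ)).comp
          (ContinuousLinearMap.snd ℂ ℂ ℂ)) x := by
      have e1 : HasFDerivAt (fun y : ℂ => ((c t, y) : ℂ × ℂ)) (ContinuousLinearMap.inr ℂ ℂ ℂ) x.2 :=
        hasFDerivAt_prodMk_right _ _
      exact ((hH (c t, x.2)).hasFDerivAt.comp x.2 e1).comp x hasFDerivAt_snd
    have h2 : HasFDerivAt (fun x : ℂ × ℂ => (c t - x.1)⁻¹)
      (((c t - x.1)^2)⁻¹ • ContinuousLinearMap.fst ℂ ℂ ℂ) x := by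
      have e1 : HasDerivAt (fun y : ℂ => (c t - y)⁻¹) (((c t - x.1)^2)⁻¹) x.1 := by
        have := ((hasDerivAt_id x.1).const_sub (c t)).inv h0
        exact this.congr_deriv (by simp [one_div])
      exact e1.comp_hasFDerivAt x hasFDerivAt_fst
    have h3 := (h2.mul (h1.const_mul ((c t - a)⁻¹))).const_mul (deriv c t)
    refine h3.congr_fderiv ?_
    ext <;> simp [mul_assoc]
  have hsub : Metric.ball x₀ (1/4) ⊆ Metric.ball x₀ (1/2) := Metric.ball_subset_ball (by norm_num)
  have hcont : ∀ x ∈ Metric.ball x₀ (1/2), Continuous (F x) := by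
    intro x hx
    have hHc := hH.continuous
    simp only [hFdef]
    refine hAc.mul ((Continuous.inv₀ (by fun_prop) (fun t => hne t x hx)).mul
      ((Continuous.inv₀ (by fun_prop) (fun t h => ?_)).mul (by fun_prop)))
    have := hca t; rw [h] at this; norm_num at this
  have hx₀m : x₀ ∈ Metric.ball x₀ (1/2) := Metric.mem_ball_self (by norm_num)
  have key := intervalIntegral.hasFDerivAt_integral_of_dominated_of_fderiv_le (𝕜 := ℂ)
    (μ := MeasureTheory.volume) (a := 0) (b := 2 * Real.pi)
    (F := F) (F' := fun x t => fderiv ℂ (fun x => F x t) x) (x₀ := x₀)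
    (s := Metric.ball x₀ (1/4)) (bound := fun _ => (4 * M + 1) / (1/4))
    (Metric.ball_mem_nhds _ (by norm_num))
    (by
      filter_upwards [Metric.ball_mem_nhds x₀ (by norm_num : (0:ℝ) < 1/2)] with x hx
      exact (hcont x hx).aestronglyMeasurable)
    ((hcont x₀ hx₀m).intervalIntegrable _ _)
    (by
      have : (fun t => fderiv ℂ (fun x => F x t) x₀) = fun t => _ :=
        funext fun t => (hFd t x₀ hx₀m).fderiv
      rw [this]
      have hHc := hH.continuous
      have m1 : Measurable (fun t => fderiv ℂ H (c t, x₀.2)) :=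
        (measurable_fderiv ℂ H).comp (by fun_prop : Continuous fun t => (c t, x₀.2)).measurable
      have m2 : Measurable (fun t => ((fderiv ℂ H (c t, x₀.2)).comp
          (ContinuousLinearMap.inr ℂ ℂ ℂ)).comp (ContinuousLinearMap.snd ℂ ℂ ℂ)) := by
        have : Continuous (fun L : ℂ × ℂ →L[ℂ] ℂ => (L.comp
          (ContinuousLinearMap.inr ℂ ℂ ℂ)).comp (ContinuousLinearMap.snd ℂ ℂ ℂ)) := by fun_prop
        exact this.measurable.comp m1
      have m3 := hAc.measurable
      have m4 := hcc.measurable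
      have m5 : Measurable (fun t => H (c t, x₀.2)) :=
        (by fun_prop : Continuous fun t => H (c t, x₀.2)).measurable
      refine Measurable.aestronglyMeasurable ?_
      exact m3.smul (((((m4.sub_const _).inv).mul ((m4.sub_const _).inv)).smul m2).add
        (((((m4.sub_const _).inv).mul m5).mul (((m4.sub_const _).pow_const 2).inv)).smul_const _)))
    (by
      refine Filter.Eventually.of_forall fun t _ x hx => ?_
      have hs : Metric.ball x (1/4) ⊆ Metric.ball x₀ (1/2) := by
        apply Metric.ball_subset_ball'
        have := Metric.mem_ball.1 hx
        linarith
      refine Complex.norm_fderiv_le_div_of_mapsTo_ball (R₁ := 1/4) (R₂ := 4 * M + 1) (fun y hy =>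
        ((hFd t y (hs hy)).differentiableAt.differentiableWithinAt)) ?_ (by norm_num)
      intro y hy
      have b1 := hFb t y (hs hy)
      have b2 := hFb t x (hsub hx)
      rw [Metric.mem_closedBall, dist_eq_norm]
      have := norm_sub_le (F y t) (F x t)
      linarith)
    (by simp)
    (by
      refine Filter.Eventually.of_forall fun t _ x hx => ?_
      exact (hFd t x (hsub hx)).differentiableAt.hasFDerivAt)
  exact key.differentiableAt

lemma aux_dslope (H : ℂ × ℂ → ℂ) (hH : Differentiable ℂ H) (a : ℂ) (hz : ∀ w, H (a, w) = 0)
    (w₀ : ℂ) :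
    DifferentiableAt ℂ (fun x : ℂ × ℂ => dslope (fun u => H (u, x.2)) a x.1) (a, w₀) := by
  have h1 := ((aux_paramInt H hH a w₀).const_smul ((2 * (Real.pi : ℂ) * I)⁻¹ : ℂ))
  refine h1.congr_of_eventuallyEq ?_
  filter_upwards [Metric.ball_mem_nhds (a, w₀) (by norm_num : (0:ℝ) < 1)] with x hx
  rw [Metric.mem_ball, Prod.dist_eq, max_lt_iff] at hx
  have hd : Differentiable ℂ (dslope (fun u => H (u, x.2)) a) := by
    rw [← differentiableOn_univ, Complex.differentiableOn_dslope Filter.univ_mem]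
    have : Differentiable ℂ (fun u => H (u, x.2)) := by fun_prop
    exact this.differentiableOn
  have := hd.diffContOnCl (s := Metric.ball a 1) |>.two_pi_i_inv_smul_circleIntegral_sub_inv_smul
    (w := x.1) hx.1
  rw [← this]
  congr 1
  refine circleIntegral.integral_congr (by norm_num) fun ζ hζ => ?_
  have hne : ζ ≠ a := by
    rintro rfl; simp at hζ
  rw [dslope_of_ne _ hne, slope_def_field]
  simp [hz, div_eq_inv_mul]

lemma aux_quot (H : ℂ × ℂ → ℂ) (hH : Differentiable ℂ H) (p : ℂ → ℂ) (hp : Differentiable ℂ p)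
    (hs : ∀ a, p a = 0 → deriv p a ≠ 0) (hz : ∀ a w, p a = 0 → H (a, w) = 0) :
    ∃ G : ℂ × ℂ → ℂ, Differentiable ℂ G ∧ ∀ u w, H (u, w) = p u * G (u, w) := by
  classical
  refine ⟨fun x => if p x.1 = 0 then deriv (fun u => H (u, x.2)) x.1 / deriv p x.1
    else H x / p x.1, ?_, ?_⟩
  · rintro ⟨a, w₀⟩
    by_cases ha : p a = 0
    · have hk : Differentiable ℂ (dslope p a) := by
        rw [← differentiableOn_univ, Complex.differentiableOn_dslope Filter.univ_mem]
        exact hp.differentiableOn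
      have hka : dslope p a a ≠ 0 := by rw [dslope_same]; exact hs a ha
      have hkx : DifferentiableAt ℂ (fun x : ℂ × ℂ => dslope p a x.1) (a, w₀) := by fun_prop
      refine ((aux_dslope H hH a (fun w => hz a w ha) w₀).fun_mul (hkx.fun_inv hka)).congr_of_eventuallyEq ?_
      filter_upwards [hkx.continuousAt.eventually_ne hka] with x hx
      rw [← div_eq_mul_inv]
      by_cases hxa : x.1 = a
      · simp [hxa, ha, dslope_same]
      · rw [dslope_of_ne _ hxa, slope_def_field] at hx
        rw [dslope_of_ne _ hxa, dslope_of_ne _ hxa, slope_def_field, slope_def_field]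
        rw [ha, sub_zero] at hx ⊢
        have hxa' : x.1 - a ≠ 0 := sub_ne_zero.2 hxa
        have : p x.1 ≠ 0 := fun h => hx (by simp [h])
        rw [if_neg this, hz a _ ha]
        field_simp
        simp
    · have hpx : DifferentiableAt ℂ (fun x : ℂ × ℂ => p x.1) (a, w₀) := by fun_prop
      refine ((hH (a, w₀)).fun_mul (hpx.fun_inv ha)).congr_of_eventuallyEq ?_
      filter_upwards [hpx.continuousAt.eventually_ne ha] with x hx
      rw [if_neg hx, div_eq_mul_inv]
  · intro u w
    by_cases h : p u = 0
    · simp [h, hz u w h]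
    · simp only [h, if_false]
      field_simp


lemma aux_lattice {Q : ℂ → Prop} {τ : ℂ} (h1 : ∀ z, Q (z + 1) ↔ Q z) (hτ : ∀ z, Q (z + τ) ↔ Q z)
    (h0 : Q 0) (a b : ℤ) : Q (a + b * τ) := by
  have hb : ∀ b : ℤ, Q (b * τ) := by
    intro b
    induction b using Int.induction_on with
    | zero => simpa using h0
    | succ k ih => have := (hτ _).2 ih; convert this using 1; push_cast; ring
    | pred k ih =>
      rw [← hτ]; convert ih using 1; push_cast; ring
  induction a using Int.induction_on with
  | zero => simpa using hb b
  | succ k ih => have := (h1 _).2 ih; convert this using 1; push_cast; ring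
  | pred k ih =>
    rw [← h1]; convert ih using 1; push_cast; ring

lemma aux_liouville {τ : ℂ} (hτ : 0 < τ.im) (f : ℂ → ℂ) (hf : Differentiable ℂ f)
    (h1 : ∀ z, f (z + 1) = f z) (h2 : ∀ z, f (z + τ) = f z) (z w : ℂ) : f z = f w := by
  apply hf.apply_eq_apply_of_bounded
  have hK : IsCompact ((fun x : ℝ × ℝ => f (x.1 + x.2 * τ)) '' (Set.Icc 0 1 ×ˢ Set.Icc 0 1)) := by
    apply (isCompact_Icc.prod isCompact_Icc).image
    have := hf.continuous
    fun_prop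
  refine hK.isBounded.subset ?_
  rintro _ ⟨z, rfl⟩
  set y : ℝ := z.im / τ.im with hy
  set x : ℝ := z.re - y * τ.re with hx
  have hz : z = x + y * τ := by
    apply Complex.ext
    · simp [hx]
    · simp [hy]; field_simp
  refine ⟨(Int.fract x, Int.fract y), ⟨⟨Int.fract_nonneg _, (Int.fract_lt_one _).le⟩,
    ⟨Int.fract_nonneg _, (Int.fract_lt_one _).le⟩⟩, ?_⟩
  have hper : ∀ a b : ℤ, ∀ v, f (v + (a + b * τ)) = f v := by
    intro a b v
    refine aux_lattice (Q := fun s => f (v + s) = f v) (τ := τ) ?_ ?_ (by simp) a b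
    · intro s; rw [← add_assoc, h1]
    · intro s; rw [← add_assoc, h2]
  refine (hper ⌊x⌋ ⌊y⌋ _).symm.trans ?_
  congr 1
  rw [hz]
  have e1 : (x : ℂ) = (⌊x⌋ : ℂ) + (Int.fract x : ℝ) := by
    exact_mod_cast (Int.floor_add_fract x).symm
  have e2 : (y : ℂ) = (⌊y⌋ : ℂ) + (Int.fract y : ℝ) := by
    exact_mod_cast (Int.floor_add_fract y).symm
  linear_combination -e1 - τ * e2

/-- The q-Pochhammer product. -/
noncomputable def auxPhi (q w : ℂ) : ℂ := ∏' k : ℕ, (1 - q ^ k * w)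

lemma aux_summ {q : ℂ} (hq : ‖q‖ < 1) (w : ℂ) : Summable fun k : ℕ => ‖-(q ^ k * w)‖ := by
  simpa using (summable_geometric_of_lt_one (norm_nonneg _) hq).mul_right ‖w‖

lemma auxPhi_diff {q : ℂ} (hq : ‖q‖ < 1) : Differentiable ℂ (auxPhi q) := by
  have h : HasProdLocallyUniformlyOn (fun (k : ℕ) w => 1 + -(q ^ k * w))
      (fun w => ∏' k : ℕ, (1 + -(q ^ k * w))) Set.univ := by
    apply hasProdLocallyUniformlyOn_of_forall_compact isOpen_univ
    intro K _ hcK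
    obtain ⟨M, hM⟩ := hcK.isBounded.exists_norm_le
    refine ((summable_geometric_of_lt_one (norm_nonneg _) hq).mul_right
      M).hasProdUniformlyOn_nat_one_add
      hcK (.of_forall fun n x hx ↦ ?_) (fun _ ↦ by fun_prop)
    rw [norm_neg, norm_mul, norm_pow]
    exact mul_le_mul_of_nonneg_left (hM x hx) (by positivity)
  rw [← differentiableOn_univ]
  have hd : ∀ s : Finset ℕ, DifferentiableOn ℂ
      (fun w : ℂ => ∏ k ∈ s, (1 + -(q ^ k * w))) Set.univ := by
    intro s
    exact DifferentiableOn.fun_finsetProd (fun _ _ => by fun_prop)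
  have e : auxPhi q = fun w => ∏' k : ℕ, (1 + -(q ^ k * w)) := by
    funext w
    simp only [auxPhi, sub_eq_add_neg]
  rw [e]
  exact h.differentiableOn (Filter.Eventually.of_forall hd) isOpen_univ

lemma auxPhi_step {q : ℂ} (hq : ‖q‖ < 1) (w : ℂ) : auxPhi q w = (1 - w) * auxPhi q (q * w) := by
  have hm : ∀ w, Multipliable fun k : ℕ => 1 - q ^ k * w := by
    intro w
    simp only [sub_eq_add_neg]
    exact multipliable_one_add_of_summable (aux_summ hq w)
  have e : (fun k : ℕ => 1 - q ^ (k+1) * w) = fun k : ℕ => 1 - q ^ k * (q * w) := by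
    funext k; ring
  have h2 : Multipliable fun k : ℕ => 1 - q ^ (k+1) * w := by
    rw [e]; exact hm (q * w)
  have h3 := tprod_eq_zero_mul' (f := fun k : ℕ => 1 - q ^ k * w) h2
  rw [e] at h3
  simp only [pow_zero, one_mul] at h3
  unfold auxPhi
  exact h3

lemma auxPhi_zero {q : ℂ} (hq : ‖q‖ < 1) (w : ℂ) (h : auxPhi q w = 0) : ∃ k : ℕ, q ^ k * w = 1 := by
  by_contra! hne
  refine tprod_one_add_ne_zero_of_summable (f := fun k : ℕ => -(q ^ k * w)) ?_ (aux_summ hq w) ?_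
  · intro i hi
    exact hne i (by linear_combination -hi)
  · simpa only [auxPhi, sub_eq_add_neg] using h

/-- The product theta function. -/
noncomputable def auxP (τ z : ℂ) : ℂ :=
  auxPhi (exp (2 * Real.pi * I * τ)) (exp (2 * Real.pi * I * z)) *
    auxPhi (exp (2 * Real.pi * I * τ)) (exp (2 * Real.pi * I * (τ - z)))

lemma aux_q {τ : ℂ} (hτ : 0 < τ.im) : ‖exp (2 * Real.pi * I * τ)‖ < 1 := by
  rw [Complex.norm_exp, Real.exp_lt_one_iff]
  simp
  positivity

lemma auxP_diff {τ : ℂ} (hτ : 0 < τ.im) : Differentiable ℂ (auxP τ) := by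
  have := auxPhi_diff (aux_q hτ)
  unfold auxP
  fun_prop

lemma auxP_one {τ : ℂ} (z : ℂ) : auxP τ (z + 1) = auxP τ z := by
  unfold auxP
  congr 2
  · rw [mul_add, mul_one, Complex.exp_add, exp_two_pi_mul_I, mul_one]
  · rw [show 2 * Real.pi * I * (τ - (z + 1)) = 2 * Real.pi * I * (τ - z) - 2 * Real.pi * I by ring,
      Complex.exp_sub, exp_two_pi_mul_I, div_one]

lemma auxP_tau {τ : ℂ} (hτ : 0 < τ.im) (z : ℂ) :
    auxP τ (z + τ) = - exp (-(2 * Real.pi * I * z)) * auxP τ z := by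
  unfold auxP
  have hq := aux_q hτ
  rw [auxPhi_step hq (exp (2 * Real.pi * I * z)),
    auxPhi_step hq (exp (2 * Real.pi * I * (τ - (z + τ)))), ← Complex.exp_add, ← Complex.exp_add]
  rw [show 2 * Real.pi * I * τ + 2 * Real.pi * I * (τ - (z + τ)) = 2 * Real.pi * I * (τ - z) by ring,
    show 2 * Real.pi * I * τ + 2 * Real.pi * I * z = 2 * Real.pi * I * (z + τ) by ring,
    show 2 * Real.pi * I * (τ - (z + τ)) = -(2 * Real.pi * I * z) by ring]
  have : exp (-(2 * Real.pi * I * z)) * exp (2 * Real.pi * I * z) = 1 := by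
    rw [← Complex.exp_add]; simp
  linear_combination (-auxPhi (exp (2 * Real.pi * I * τ)) (exp (2 * Real.pi * I * (z + τ))) * auxPhi (exp (2 * Real.pi * I * τ)) (exp (2 * Real.pi * I * (τ - z)))) * this

lemma auxP_zero {τ : ℂ} (hτ : 0 < τ.im) (z : ℂ) (h : auxP τ z = 0) :
    ∃ a b : ℤ, z = a + b * τ := by
  have hpi : (2 * Real.pi * I : ℂ) ≠ 0 := two_pi_I_ne_zero
  rcases mul_eq_zero.1 h with h | h
  · obtain ⟨k, hk⟩ := auxPhi_zero (aux_q hτ) _ h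
    rw [← Complex.exp_nat_mul, ← Complex.exp_add, Complex.exp_eq_one_iff] at hk
    obtain ⟨m, hm⟩ := hk
    refine ⟨m, -k, ?_⟩
    apply mul_left_cancel₀ hpi
    push_cast
    linear_combination hm
  · obtain ⟨k, hk⟩ := auxPhi_zero (aux_q hτ) _ h
    rw [← Complex.exp_nat_mul, ← Complex.exp_add, Complex.exp_eq_one_iff] at hk
    obtain ⟨m, hm⟩ := hk
    refine ⟨-m, k + 1, ?_⟩
    apply mul_left_cancel₀ hpi
    push_cast
    linear_combination -hm

lemma auxPhi_q_ne {q : ℂ} (hq : ‖q‖ < 1) : auxPhi q q ≠ 0 := by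
  intro h
  obtain ⟨k, hk⟩ := auxPhi_zero hq _ h
  have := congrArg norm hk
  rw [← pow_succ, norm_pow, norm_one] at this
  exact (pow_lt_one₀ (norm_nonneg q) hq (Nat.succ_ne_zero k)).ne this

lemma auxP_deriv0 {τ : ℂ} (hτ : 0 < τ.im) : auxP τ 0 = 0 ∧ deriv (auxP τ) 0 ≠ 0 := by
  have hq := aux_q hτ
  set q := exp (2 * Real.pi * I * τ) with hqd
  have hd := auxPhi_diff hq
  have hP : auxP τ = fun z => (1 - exp (2 * Real.pi * I * z)) * (auxPhi q (q * exp (2 * Real.pi * I * z)) *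
    auxPhi q (exp (2 * Real.pi * I * (τ - z)))) := by
    ext z
    unfold auxP
    rw [← hqd, auxPhi_step hq (exp (2 * Real.pi * I * z)), mul_assoc]
  refine ⟨by rw [hP]; simp, ?_⟩
  have e1 : HasDerivAt (fun z : ℂ => 1 - exp (2 * Real.pi * I * z)) (-(2 * Real.pi * I)) 0 := by
    have := (((hasDerivAt_id (0:ℂ)).const_mul (2 * Real.pi * I : ℂ)).cexp).const_sub 1
    simpa using this
  have e2 : DifferentiableAt ℂ (fun z => auxPhi q (q * exp (2 * Real.pi * I * z)) *
    auxPhi q (exp (2 * Real.pi * I * (τ - z)))) 0 := by fun_prop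
  have := (e1.mul e2.hasDerivAt).deriv
  rw [hP]
  have h3 : deriv (fun z => (1 - exp (2 * Real.pi * I * z)) * (auxPhi q (q * exp (2 * Real.pi * I * z)) *
    auxPhi q (exp (2 * Real.pi * I * (τ - z))))) 0 = -(2 * Real.pi * I) * (auxPhi q q * auxPhi q q) := by
    refine this.trans ?_
    simp [← hqd]
  rw [h3]
  have := auxPhi_q_ne hq
  exact mul_ne_zero (neg_ne_zero.2 two_pi_I_ne_zero) (mul_ne_zero this this)

/-- simple zero propagates -/
lemma aux_simple_shift {p : ℂ → ℂ} (hp : Differentiable ℂ p) {g : ℂ → ℂ} (hg : Differentiable ℂ g)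
    (hg0 : ∀ z, g z ≠ 0) (s : ℂ) (h : ∀ z, p (z + s) = g z * p z) (z : ℂ) :
    (p (z + s) = 0 ∧ deriv p (z + s) ≠ 0) ↔ (p z = 0 ∧ deriv p z ≠ 0) := by
  have h1 : deriv p (z + s) = deriv g z * p z + g z * deriv p z := by
    rw [← deriv_comp_add_const]
    have : (fun x => p (x + s)) = fun x => g x * p x := funext h
    rw [this]
    exact deriv_fun_mul (hg z) (hp z)
  rw [h1, h]
  constructor
  · rintro ⟨a, b⟩
    have a' : p z = 0 := (mul_eq_zero.1 a).resolve_left (hg0 z)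
    rw [a'] at b
    exact ⟨a', fun hh => b (by simp [hh])⟩
  · rintro ⟨a, b⟩
    simp [a, b, hg0 z]

lemma auxP_simple {τ : ℂ} (hτ : 0 < τ.im) (a b : ℤ) :
    auxP τ (a + b * τ) = 0 ∧ deriv (auxP τ) (a + b * τ) ≠ 0 := by
  refine aux_lattice (Q := fun z => auxP τ z = 0 ∧ deriv (auxP τ) z ≠ 0) ?_ ?_ (auxP_deriv0 hτ) a b
  · exact aux_simple_shift (auxP_diff hτ) (g := fun _ => 1) (by fun_prop) (by simp) 1
      (by simp [auxP_one])
  · exact aux_simple_shift (auxP_diff hτ) (g := fun z => - exp (-(2 * Real.pi * I * z)))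
      (by fun_prop) (by simp) τ (auxP_tau hτ)

lemma aux_cancel {p f : ℂ → ℂ} (hp : Differentiable ℂ p) (hs : ∀ a, p a = 0 → deriv p a ≠ 0)
    (hf : Continuous f) (h : ∀ u, p u * f u = 0) (u : ℂ) : f u = 0 := by
  by_cases hu : p u = 0
  · have h1 : ∀ᶠ z in nhdsWithin u {u}ᶜ, p z ≠ 0 :=
      (hp u).hasDerivAt.eventually_ne (hs u hu)
    have h2 : Filter.Tendsto f (nhdsWithin u {u}ᶜ) (nhds 0) := by
      refine (tendsto_const_nhds (x := (0:ℂ))).congr' ?_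
      filter_upwards [h1] with z hz
      exact ((mul_eq_zero.1 (h z)).resolve_left hz).symm
    exact tendsto_nhds_unique (hf.continuousAt.tendsto.mono_left nhdsWithin_le_nhds) h2
  · exact (mul_eq_zero.1 (h u)).resolve_left hu

lemma theta1_eq (τ z : ℂ) : theta1 τ z =
    -(exp (Real.pi * I * τ / 4 + Real.pi * I * (z + 1 / 2)) *
      jacobiTheta₂ (z + 1 / 2 + τ / 2) τ) := by
  unfold theta1 jacobiTheta₂
  rw [← tsum_mul_left]
  congr 1
  refine tsum_congr fun m => ?_
  rw [jacobiTheta₂_term, ← Complex.exp_add]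
  congr 1
  ring

lemma theta1_diff {τ : ℂ} (hτ : 0 < τ.im) : Differentiable ℂ (theta1 τ) := by
  have h : Differentiable ℂ (fun z => jacobiTheta₂ z τ) :=
    fun z => differentiableAt_jacobiTheta₂_fst z hτ
  rw [show theta1 τ = _ from funext (theta1_eq τ)]
  have h2 : Differentiable ℂ (fun z => jacobiTheta₂ (z + 1 / 2 + τ / 2) τ) :=
    h.comp (by fun_prop : Differentiable ℂ fun z : ℂ => z + 1 / 2 + τ / 2)
  fun_prop

lemma theta1_one (τ z : ℂ) : theta1 τ (z + 1) = - theta1 τ z := by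
  rw [theta1_eq, theta1_eq]
  rw [show z + 1 + 1 / 2 + τ / 2 = z + 1 / 2 + τ / 2 + 1 by ring, jacobiTheta₂_add_left,
    show Real.pi * I * τ / 4 + Real.pi * I * (z + 1 + 1 / 2) =
      Real.pi * I * τ / 4 + Real.pi * I * (z + 1 / 2) + Real.pi * I by ring,
    Complex.exp_add _ (Real.pi * I), exp_pi_mul_I]
  ring

lemma theta1_tau (τ z : ℂ) : theta1 τ (z + τ) =
    - exp (-(Real.pi * I * τ) - 2 * Real.pi * I * z) * theta1 τ z := by
  rw [theta1_eq, theta1_eq]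
  rw [show z + τ + 1 / 2 + τ / 2 = z + 1 / 2 + τ / 2 + τ by ring, jacobiTheta₂_add_left']
  have e : exp (Real.pi * I * τ / 4 + Real.pi * I * (z + τ + 1 / 2)) *
      exp (-Real.pi * I * (τ + 2 * (z + 1 / 2 + τ / 2))) =
      - (exp (-(Real.pi * I * τ) - 2 * Real.pi * I * z) *
        exp (Real.pi * I * τ / 4 + Real.pi * I * (z + 1 / 2))) := by
    rw [← Complex.exp_add, ← Complex.exp_add,
      show Real.pi * I * τ / 4 + Real.pi * I * (z + τ + 1 / 2) +
        -Real.pi * I * (τ + 2 * (z + 1 / 2 + τ / 2)) =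
        -(Real.pi * I * τ) - 2 * Real.pi * I * z +
        (Real.pi * I * τ / 4 + Real.pi * I * (z + 1 / 2)) + -(Real.pi * I) by ring,
      Complex.exp_add _ (-(Real.pi * I)), Complex.exp_neg (Real.pi * I), exp_pi_mul_I]
    ring
  linear_combination (-jacobiTheta₂ (z + 1 / 2 + τ / 2) τ) * e

lemma theta1_zero (τ : ℂ) : theta1 τ 0 = 0 := by
  rw [theta1_eq]
  have h1 := jacobiTheta₂_add_left' (1 / 2 - τ / 2) τ
  have h2 : jacobiTheta₂ (1 / 2 - τ / 2) τ = jacobiTheta₂ (1 / 2 + τ / 2) τ := by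
    rw [← jacobiTheta₂_neg_left (1 / 2 + τ / 2), ← jacobiTheta₂_add_left (-(1 / 2 + τ / 2))]
    congr 1; ring
  rw [h2, show (1 / 2 - τ / 2 + τ : ℂ) = 1 / 2 + τ / 2 by ring,
    show -Real.pi * I * (τ + 2 * (1 / 2 - τ / 2)) = -(Real.pi * I) by ring, Complex.exp_neg,
    exp_pi_mul_I] at h1
  have h3 : jacobiTheta₂ (1 / 2 + τ / 2) τ = 0 := by
    linear_combination (1 / 2) * h1
  rw [zero_add, h3]; simp

lemma theta1_lattice (τ : ℂ) (a b : ℤ) : theta1 τ (a + b * τ) = 0 := by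
  refine aux_lattice (Q := fun z => theta1 τ z = 0) ?_ ?_ (theta1_zero τ) a b
  · intro z; simp [theta1_one]
  · intro z; simp [theta1_tau]

lemma theta1_eq_P {τ : ℂ} (hτ : 0 < τ.im) :
    ∃ c : ℂ, ∀ z, theta1 τ z = c * exp (-(Real.pi * I * z)) * auxP τ z := by
  have hT := theta1_diff hτ
  have hP := auxP_diff hτ
  have hs : ∀ a, auxP τ a = 0 → deriv (auxP τ) a ≠ 0 := by
    intro a ha
    obtain ⟨m, k, rfl⟩ := auxP_zero hτ a ha
    exact (auxP_simple hτ m k).2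
  obtain ⟨G, hG, hGe⟩ := aux_quot (fun x => exp (Real.pi * I * x.1) * theta1 τ x.1) (by fun_prop)
    (auxP τ) hP hs (by
      intro a w ha
      obtain ⟨m, k, rfl⟩ := auxP_zero hτ a ha
      simp [theta1_lattice])
  set g : ℂ → ℂ := fun u => G (u, 0) with hg
  have hgd : Differentiable ℂ g := by fun_prop
  have hge : ∀ u, exp (Real.pi * I * u) * theta1 τ u = auxP τ u * g u := fun u => hGe u 0
  have hz : ∀ f : ℂ → ℂ, Differentiable ℂ f → (∀ u, auxP τ u * f u = 0) → ∀ u, f u = 0 :=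
    fun f hf h => aux_cancel hP hs hf.continuous h
  have g1 : ∀ u, g (u + 1) = g u := by
    intro u
    rw [← sub_eq_zero]
    refine hz (fun u => g (u + 1) - g u) (by fun_prop) ?_ u
    intro u
    have a1 := hge (u + 1)
    have a2 := hge u
    rw [auxP_one, theta1_one, mul_add, Complex.exp_add, mul_one, exp_pi_mul_I] at a1
    linear_combination a2 - a1
  have g2 : ∀ u, g (u + τ) = g u := by
    intro u
    rw [← sub_eq_zero]
    refine hz (fun u => g (u + τ) - g u) (by fun_prop) ?_ u
    intro u
    have a1 := hge (u + τ)
    have a2 := hge u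
    rw [auxP_tau hτ, theta1_tau] at a1
    have e : exp (Real.pi * I * (u + τ)) * exp (-(Real.pi * I * τ) - 2 * Real.pi * I * u) =
        exp (-(2 * Real.pi * I * u)) * exp (Real.pi * I * u) := by
      rw [← Complex.exp_add, ← Complex.exp_add]; congr 1; ring
    apply mul_left_cancel₀ (Complex.exp_ne_zero (-(2 * Real.pi * I * u)))
    linear_combination exp (-(2 * Real.pi * I * u)) * a2 + a1 + theta1 τ u * e
  refine ⟨g 0, fun z => ?_⟩
  have := hge z
  rw [aux_liouville hτ g hgd g1 g2 z 0] at this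
  have e : exp (-(Real.pi * I * z)) * exp (Real.pi * I * z) = 1 := by
    rw [← Complex.exp_add]; simp
  linear_combination exp (-(Real.pi * I * z)) * this - theta1 τ z * e

lemma theta1_simple {τ : ℂ} (hτ : 0 < τ.im) {κ : ℂ} (hκ : theta1 τ κ ≠ 0) (z : ℂ)
    (hz : theta1 τ z = 0) : (∃ a b : ℤ, z = a + b * τ) ∧ deriv (theta1 τ) z ≠ 0 := by
  obtain ⟨c, hc⟩ := theta1_eq_P hτ
  have hc0 : c ≠ 0 := by
    rintro rfl; exact hκ (by rw [hc]; simp)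
  have hz' := hz
  rw [hc] at hz'
  have hPz : auxP τ z = 0 := by simpa [hc0] using hz'
  have hl := auxP_zero hτ z hPz
  refine ⟨hl, ?_⟩
  obtain ⟨a, b, hab⟩ := hl
  have hd := (auxP_simple hτ a b).2
  rw [← hab] at hd
  rw [show theta1 τ = _ from funext hc]
  rw [deriv_fun_mul (by fun_prop) (auxP_diff hτ z), hPz]
  simp [hc0, hd]

lemma aux_N11 (n : ℕ) (τ lam κ l k D : ℂ) (hl' : lam = n * l) (hk' : κ = n * k)
    (T : ℂ → ℂ) (F : ℂ × ℂ → ℂ) (N : ℂ → ℂ → ℂ)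
    (hN : ∀ z₁ z₂, N z₁ z₂ = D * T (z₁ - z₂ - (l + k) + lam) * F (z₂ + l, z₁ - l) -
      T lam * D / T κ * T (z₁ - z₂ - (l + k) + κ) * F (z₁ - k, z₂ + k))
    (T1 : ∀ z, T (z + 1) = - T z)
    (Tτ : ∀ z, T (z + τ) = - exp (-(Real.pi * I * τ) - 2 * Real.pi * I * z) * T z)
    (T1' : ∀ z, T (z - 1) = - T z)
    (Tτ' : ∀ z, T (z - τ) = - exp (-(Real.pi * I * τ) + 2 * Real.pi * I * z) * T z)
    (F11 : ∀ z w, F (z + 1, w) = (-1) ^ (n - 1) * F (z, w))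
    (F21 : ∀ z w, F (z, w + 1) = (-1) ^ (n - 1) * F (z, w))
    (F1τ : ∀ z w, F (z + τ, w) = exp (-(Real.pi : ℂ) * I * n * τ - 2 * Real.pi * I * n * z) *
    F (z, w))
    (F2τ : ∀ z w, F (z, w + τ) = exp (-(Real.pi : ℂ) * I * n * τ - 2 * Real.pi * I * n * w) *
    F (z, w)) :
    ∀ z w, N (z + 1) w = -(-1) ^ (n - 1) * N z w := by
  intro z w
  simp only [hN]
  rw [show z + 1 - w - (l + k) + lam = z - w - (l + k) + lam + 1 by ring,
    show z + 1 - w - (l + k) + κ = z - w - (l + k) + κ + 1 by ring,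
    show z + 1 - l = z - l + 1 by ring, show z + 1 - k = z - k + 1 by ring, T1, T1, F11, F21]
  ring

lemma aux_N21 (n : ℕ) (τ lam κ l k D : ℂ) (hl' : lam = n * l) (hk' : κ = n * k)
    (T : ℂ → ℂ) (F : ℂ × ℂ → ℂ) (N : ℂ → ℂ → ℂ)
    (hN : ∀ z₁ z₂, N z₁ z₂ = D * T (z₁ - z₂ - (l + k) + lam) * F (z₂ + l, z₁ - l) -
      T lam * D / T κ * T (z₁ - z₂ - (l + k) + κ) * F (z₁ - k, z₂ + k))
    (T1 : ∀ z, T (z + 1) = - T z)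
    (Tτ : ∀ z, T (z + τ) = - exp (-(Real.pi * I * τ) - 2 * Real.pi * I * z) * T z)
    (T1' : ∀ z, T (z - 1) = - T z)
    (Tτ' : ∀ z, T (z - τ) = - exp (-(Real.pi * I * τ) + 2 * Real.pi * I * z) * T z)
    (F11 : ∀ z w, F (z + 1, w) = (-1) ^ (n - 1) * F (z, w))
    (F21 : ∀ z w, F (z, w + 1) = (-1) ^ (n - 1) * F (z, w))
    (F1τ : ∀ z w, F (z + τ, w) = exp (-(Real.pi : ℂ) * I * n * τ - 2 * Real.pi * I * n * z) *
    F (z, w))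
    (F2τ : ∀ z w, F (z, w + τ) = exp (-(Real.pi : ℂ) * I * n * τ - 2 * Real.pi * I * n * w) *
    F (z, w)) :
    ∀ z w, N z (w + 1) = -(-1) ^ (n - 1) * N z w := by
  intro z w
  simp only [hN]
  rw [show z - (w + 1) - (l + k) + lam = z - w - (l + k) + lam - 1 by ring,
    show z - (w + 1) - (l + k) + κ = z - w - (l + k) + κ - 1 by ring,
    show w + 1 + l = w + l + 1 by ring, show w + 1 + k = w + k + 1 by ring, T1', T1', F11, F21]
  ring

lemma aux_N1τ (n : ℕ) (τ lam κ l k D : ℂ) (hl' : lam = n * l) (hk' : κ = n * k)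
    (T : ℂ → ℂ) (F : ℂ × ℂ → ℂ) (N : ℂ → ℂ → ℂ)
    (hN : ∀ z₁ z₂, N z₁ z₂ = D * T (z₁ - z₂ - (l + k) + lam) * F (z₂ + l, z₁ - l) -
      T lam * D / T κ * T (z₁ - z₂ - (l + k) + κ) * F (z₁ - k, z₂ + k))
    (T1 : ∀ z, T (z + 1) = - T z)
    (Tτ : ∀ z, T (z + τ) = - exp (-(Real.pi * I * τ) - 2 * Real.pi * I * z) * T z)
    (T1' : ∀ z, T (z - 1) = - T z)
    (Tτ' : ∀ z, T (z - τ) = - exp (-(Real.pi * I * τ) + 2 * Real.pi * I * z) * T z)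
    (F11 : ∀ z w, F (z + 1, w) = (-1) ^ (n - 1) * F (z, w))
    (F21 : ∀ z w, F (z, w + 1) = (-1) ^ (n - 1) * F (z, w))
    (F1τ : ∀ z w, F (z + τ, w) = exp (-(Real.pi : ℂ) * I * n * τ - 2 * Real.pi * I * n * z) *
    F (z, w))
    (F2τ : ∀ z w, F (z, w + τ) = exp (-(Real.pi : ℂ) * I * n * τ - 2 * Real.pi * I * n * w) *
    F (z, w)) :
    ∀ z w, N (z + τ) w = -(exp (-(Real.pi * I * τ) - 2 * Real.pi * I * (z - w - (l + k))) *
      exp (-(Real.pi : ℂ) * I * n * τ - 2 * Real.pi * I * n * z)) * N z w := by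
  intro z w
  simp only [hN]
  rw [show z + τ - w - (l + k) + lam = z - w - (l + k) + lam + τ by ring,
    show z + τ - w - (l + k) + κ = z - w - (l + k) + κ + τ by ring,
    show z + τ - l = z - l + τ by ring, show z + τ - k = z - k + τ by ring, Tτ, Tτ, F1τ, F2τ]
  have e1 : exp (-(Real.pi * I * τ) - 2 * Real.pi * I * (z - w - (l + k) + lam)) *
      exp (-(Real.pi : ℂ) * I * n * τ - 2 * Real.pi * I * n * (z - l)) =
      exp (-(Real.pi * I * τ) - 2 * Real.pi * I * (z - w - (l + k))) *
    exp (-(Real.pi : ℂ) * I * n * τ - 2 * Real.pi * I * n * z) := by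
    rw [← Complex.exp_add, ← Complex.exp_add, hl']; congr 1; ring
  have e2 : exp (-(Real.pi * I * τ) - 2 * Real.pi * I * (z - w - (l + k) + κ)) *
      exp (-(Real.pi : ℂ) * I * n * τ - 2 * Real.pi * I * n * (z - k)) =
      exp (-(Real.pi * I * τ) - 2 * Real.pi * I * (z - w - (l + k))) *
    exp (-(Real.pi : ℂ) * I * n * τ - 2 * Real.pi * I * n * z) := by
    rw [← Complex.exp_add, ← Complex.exp_add, hk']; congr 1; ring
  linear_combination (-(D * T (z - w - (l + k) + lam) * F (w + l, z - l))) * e1 +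
    (T lam * D / T κ * T (z - w - (l + k) + κ) * F (z - k, w + k)) * e2

lemma aux_N2τ (n : ℕ) (τ lam κ l k D : ℂ) (hl' : lam = n * l) (hk' : κ = n * k)
    (T : ℂ → ℂ) (F : ℂ × ℂ → ℂ) (N : ℂ → ℂ → ℂ)
    (hN : ∀ z₁ z₂, N z₁ z₂ = D * T (z₁ - z₂ - (l + k) + lam) * F (z₂ + l, z₁ - l) -
      T lam * D / T κ * T (z₁ - z₂ - (l + k) + κ) * F (z₁ - k, z₂ + k))
    (T1 : ∀ z, T (z + 1) = - T z)
    (Tτ : ∀ z, T (z + τ) = - exp (-(Real.pi * I * τ) - 2 * Real.pi * I * z) * T z)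
    (T1' : ∀ z, T (z - 1) = - T z)
    (Tτ' : ∀ z, T (z - τ) = - exp (-(Real.pi * I * τ) + 2 * Real.pi * I * z) * T z)
    (F11 : ∀ z w, F (z + 1, w) = (-1) ^ (n - 1) * F (z, w))
    (F21 : ∀ z w, F (z, w + 1) = (-1) ^ (n - 1) * F (z, w))
    (F1τ : ∀ z w, F (z + τ, w) = exp (-(Real.pi : ℂ) * I * n * τ - 2 * Real.pi * I * n * z) *
    F (z, w))
    (F2τ : ∀ z w, F (z, w + τ) = exp (-(Real.pi : ℂ) * I * n * τ - 2 * Real.pi * I * n * w) *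
    F (z, w)) :
    ∀ z w, N z (w + τ) = -(exp (-(Real.pi * I * τ) + 2 * Real.pi * I * (z - w - (l + k))) *
      exp (-(Real.pi : ℂ) * I * n * τ - 2 * Real.pi * I * n * w)) * N z w := by
  intro z w
  simp only [hN]
  rw [show z - (w + τ) - (l + k) + lam = z - w - (l + k) + lam - τ by ring,
    show z - (w + τ) - (l + k) + κ = z - w - (l + k) + κ - τ by ring,
    show w + τ + l = w + l + τ by ring, show w + τ + k = w + k + τ by ring, Tτ', Tτ', F1τ, F2τ]
  have e1 : exp (-(Real.pi * I * τ) + 2 * Real.pi * I * (z - w - (l + k) + lam)) *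
      exp (-(Real.pi : ℂ) * I * n * τ - 2 * Real.pi * I * n * (w + l)) =
      exp (-(Real.pi * I * τ) + 2 * Real.pi * I * (z - w - (l + k))) *
    exp (-(Real.pi : ℂ) * I * n * τ - 2 * Real.pi * I * n * w) := by
    rw [← Complex.exp_add, ← Complex.exp_add, hl']; congr 1; ring
  have e2 : exp (-(Real.pi * I * τ) + 2 * Real.pi * I * (z - w - (l + k) + κ)) *
      exp (-(Real.pi : ℂ) * I * n * τ - 2 * Real.pi * I * n * (w + k)) =
      exp (-(Real.pi * I * τ) + 2 * Real.pi * I * (z - w - (l + k))) *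
    exp (-(Real.pi : ℂ) * I * n * τ - 2 * Real.pi * I * n * w) := by
    rw [← Complex.exp_add, ← Complex.exp_add, hk']; congr 1; ring
  linear_combination (-(D * T (z - w - (l + k) + lam) * F (w + l, z - l))) * e1 +
    (T lam * D / T κ * T (z - w - (l + k) + κ) * F (z - k, w + k)) * e2

lemma aux_N0 (n : ℕ) (τ lam κ l k D : ℂ) (hl' : lam = n * l) (hk' : κ = n * k)
    (T : ℂ → ℂ) (F : ℂ × ℂ → ℂ) (N : ℂ → ℂ → ℂ)
    (hN : ∀ z₁ z₂, N z₁ z₂ = D * T (z₁ - z₂ - (l + k) + lam) * F (z₂ + l, z₁ - l) -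
      T lam * D / T κ * T (z₁ - z₂ - (l + k) + κ) * F (z₁ - k, z₂ + k))
    (hκ : T κ ≠ 0) :
    ∀ w, N (w + (l + k)) w = 0 := by
  intro w
  simp only [hN]
  rw [show w + (l + k) - w - (l + k) + lam = lam by ring,
    show w + (l + k) - w - (l + k) + κ = κ by ring,
    show w + (l + k) - l = w + k by ring, show w + (l + k) - k = w + l by ring]
  field_simp
  ring

lemma aux_G (n : ℕ) (τ l k : ℂ) (T : ℂ → ℂ) (N : ℂ → ℂ → ℂ) (hTd : Differentiable ℂ T)
    (hTs : ∀ a, T a = 0 → deriv T a ≠ 0) (hTl : ∀ a, T a = 0 → ∃ m j : ℤ, a = m + j * τ)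
    (T1 : ∀ z, T (z + 1) = - T z)
    (Tτ : ∀ z, T (z + τ) = - exp (-(Real.pi * I * τ) - 2 * Real.pi * I * z) * T z)
    (T1' : ∀ z, T (z - 1) = - T z)
    (Tτ' : ∀ z, T (z - τ) = - exp (-(Real.pi * I * τ) + 2 * Real.pi * I * z) * T z)
    (N11 : ∀ z w, N (z + 1) w = -(-1) ^ (n - 1) * N z w)
    (N21 : ∀ z w, N z (w + 1) = -(-1) ^ (n - 1) * N z w)
    (N1τ : ∀ z w, N (z + τ) w = -(exp (-(Real.pi * I * τ) - 2 * Real.pi * I * (z - w - (l + k))) *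
      exp (-(Real.pi : ℂ) * I * n * τ - 2 * Real.pi * I * n * z)) * N z w)
    (N2τ : ∀ z w, N z (w + τ) = -(exp (-(Real.pi * I * τ) + 2 * Real.pi * I * (z - w - (l + k))) *
      exp (-(Real.pi : ℂ) * I * n * τ - 2 * Real.pi * I * n * w)) * N z w)
    (N0 : ∀ w, N (w + (l + k)) w = 0) (hNd : Differentiable ℂ (fun x : ℂ × ℂ => N x.1 x.2)) :
    ∃ G : ℂ × ℂ → ℂ, Differentiable ℂ G ∧
      (∀ z₂ : ℂ, MemVe n τ (fun z₁ => G (z₁, z₂))) ∧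
      (∀ z₁ : ℂ, MemVe n τ (fun z₂ => G (z₁, z₂))) ∧
      ∀ z w, N z w = T (z - w - (l + k)) * G (z, w) := by
  obtain ⟨G, hG, hGe⟩ := aux_quot (fun x => N (x.1 + x.2 + (l + k)) x.2)
    (hNd.comp (by fun_prop : Differentiable ℂ fun x : ℂ × ℂ => (x.1 + x.2 + (l + k), x.2)))
    T hTd hTs (by
      intro a w ha
      obtain ⟨m, j, rfl⟩ := hTl a ha
      refine aux_lattice (Q := fun s => N (s + w + (l + k)) w = 0) ?_ ?_ ?_ m j
      · intro s
        rw [show s + 1 + w + (l + k) = s + w + (l + k) + 1 by ring, N11]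
        simp
      · intro s
        rw [show s + τ + w + (l + k) = s + w + (l + k) + τ by ring, N1τ]
        simp
      · simpa using N0 w)
  have hGN : ∀ z w, N z w = T (z - w - (l + k)) * G (z - w - (l + k), w) := by
    intro z w
    rw [← hGe]
    show N z w = N (z - w - (l + k) + w + (l + k)) w
    rw [show z - w - (l + k) + w + (l + k) = z by ring]
  have hcan : ∀ f : ℂ → ℂ, Differentiable ℂ f → (∀ u, T u * f u = 0) → ∀ u, f u = 0 :=
    fun f hf h => aux_cancel hTd hTs hf.continuous h
  have hG1 : Differentiable ℂ (fun x : ℂ × ℂ => G (x.1 - x.2 - (l + k), x.2)) := by fun_prop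
  refine ⟨fun x => G (x.1 - x.2 - (l + k), x.2), hG1, ?_, ?_, ?_⟩
  · intro w
    refine ⟨by fun_prop, ?_, ?_⟩
    · intro z
      have := hcan (fun u => G (u + 1, w) - (-1) ^ (n - 1) * G (u, w)) (by fun_prop) ?_
        (z - w - (l + k))
      · beta_reduce
        rw [show z + 1 - w - (l + k) = z - w - (l + k) + 1 by ring]
        linear_combination this
      · intro u
        have a := N11 (u + w + (l + k)) w
        rw [hGN, hGN, show u + w + (l + k) + 1 - w - (l + k) = u + 1 by ring,
          show u + w + (l + k) - w - (l + k) = u by ring, T1] at a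
        linear_combination -a
    · intro z
      have := hcan (fun u => G (u + τ, w) - exp (-(Real.pi : ℂ) * I * n * τ -
        2 * Real.pi * I * n * (u + w + (l + k))) * G (u, w)) (by fun_prop) ?_
        (z - w - (l + k))
      · beta_reduce
        rw [show z + τ - w - (l + k) = z - w - (l + k) + τ by ring]
        rw [show z - w - (l + k) + w + (l + k) = z by ring] at this
        linear_combination this
      · intro u
        have a := N1τ (u + w + (l + k)) w
        rw [hGN, hGN, show u + w + (l + k) + τ - w - (l + k) = u + τ by ring,
          show u + w + (l + k) - w - (l + k) = u by ring, Tτ] at a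
        apply mul_left_cancel₀ (Complex.exp_ne_zero (-(Real.pi * I * τ) - 2 * Real.pi * I * u))
        linear_combination -a
  · intro z
    refine ⟨by fun_prop, ?_, ?_⟩
    · intro w
      have := hcan (fun u => G (u - 1, z - u - (l + k) + 1) -
        (-1) ^ (n - 1) * G (u, z - u - (l + k))) (by fun_prop) ?_ (z - w - (l + k))
      · beta_reduce
        rw [show z - (z - w - (l + k)) - (l + k) = w by ring] at this
        rw [show z - (w + 1) - (l + k) = z - w - (l + k) - 1 by ring]
        linear_combination this
      · intro u
        have a := N21 z (z - u - (l + k))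
        rw [hGN, hGN, show z - (z - u - (l + k) + 1) - (l + k) = u - 1 by ring,
          show z - (z - u - (l + k)) - (l + k) = u by ring, T1'] at a
        linear_combination -a
    · intro w
      have := hcan (fun u => G (u - τ, z - u - (l + k) + τ) - exp (-(Real.pi : ℂ) * I * n * τ -
        2 * Real.pi * I * n * (z - u - (l + k))) * G (u, z - u - (l + k))) (by fun_prop) ?_
        (z - w - (l + k))
      · beta_reduce
        rw [show z - (z - w - (l + k)) - (l + k) = w by ring] at this
        rw [show z - (w + τ) - (l + k) = z - w - (l + k) - τ by ring]
        linear_combination this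
      · intro u
        have a := N2τ z (z - u - (l + k))
        rw [hGN, hGN, show z - (z - u - (l + k) + τ) - (l + k) = u - τ by ring,
          show z - (z - u - (l + k)) - (l + k) = u by ring, Tτ'] at a
        apply mul_left_cancel₀ (Complex.exp_ne_zero (-(Real.pi * I * τ) + 2 * Real.pi * I * u))
        linear_combination -a
  · exact hGN

theorem RopE_preserves_Ve (n : ℕ) (hn : 1 ≤ n) (τ : ℂ) (hτ : 0 < τ.im)
    (lam κ : ℂ) (hκ : theta1 τ κ ≠ 0)
    (F : ℂ × ℂ → ℂ) (hF : Differentiable ℂ F)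
    (hF1 : ∀ z₂ : ℂ, MemVe n τ (fun z₁ => F (z₁, z₂)))
    (hF2 : ∀ z₁ : ℂ, MemVe n τ (fun z₂ => F (z₁, z₂))) :
    ∃ G : ℂ × ℂ → ℂ, Differentiable ℂ G ∧
      (∀ z₂ : ℂ, MemVe n τ (fun z₁ => G (z₁, z₂))) ∧
      (∀ z₁ : ℂ, MemVe n τ (fun z₂ => G (z₁, z₂))) ∧
      ∀ z₁ z₂ : ℂ, theta1 τ (z₁ - z₂ - (lam + κ) / (n : ℂ)) ≠ 0 →
        G (z₁, z₂) = RopE n τ lam κ F z₁ z₂ := by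
  have hn0 : (n : ℂ) ≠ 0 := by exact_mod_cast (by omega : n ≠ 0)
  unfold RopE
  obtain ⟨l, hl⟩ : ∃ l, lam / (n : ℂ) = l := ⟨_, rfl⟩
  obtain ⟨k, hk⟩ : ∃ k, κ / (n : ℂ) = k := ⟨_, rfl⟩
  have hl' : lam = n * l := by rw [← hl]; field_simp
  have hk' : κ = n * k := by rw [← hk]; field_simp
  rw [add_div, hl, hk]
  obtain ⟨T, hT⟩ : ∃ T, theta1 τ = T := ⟨_, rfl⟩
  have hTd : Differentiable ℂ T := hT ▸ theta1_diff hτ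
  have T1 : ∀ z, T (z + 1) = - T z := hT ▸ theta1_one τ
  have Tτ : ∀ z, T (z + τ) = - exp (-(Real.pi * I * τ) - 2 * Real.pi * I * z) * T z :=
    hT ▸ theta1_tau τ
  have hTs : ∀ a, T a = 0 → deriv T a ≠ 0 := hT ▸ fun a ha => (theta1_simple hτ hκ a ha).2
  have hTl : ∀ a, T a = 0 → ∃ m j : ℤ, a = m + j * τ :=
    hT ▸ fun a ha => (theta1_simple hτ hκ a ha).1
  rw [hT] at hκ
  rw [hT]
  clear hT
  have T1' : ∀ z, T (z - 1) = - T z := by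
    intro z; have := T1 (z - 1); rw [sub_add_cancel] at this; rw [this, neg_neg]
  have Tτ' : ∀ z, T (z - τ) = - exp (-(Real.pi * I * τ) + 2 * Real.pi * I * z) * T z := by
    intro z; have := Tτ (z - τ); rw [sub_add_cancel] at this; rw [this]
    have e : exp (-(Real.pi * I * τ) + 2 * Real.pi * I * z) *
      exp (-(Real.pi * I * τ) - 2 * Real.pi * I * (z - τ)) = 1 := by
      rw [← Complex.exp_add, ← Complex.exp_zero]; congr 1; ring
    linear_combination (- T (z - τ)) * e
  have F11 : ∀ z w, F (z + 1, w) = (-1) ^ (n - 1) * F (z, w) := fun z w => (hF1 w).2.1 z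
  have F21 : ∀ z w, F (z, w + 1) = (-1) ^ (n - 1) * F (z, w) := fun z w => (hF2 z).2.1 w
  have F1τ : ∀ z w, F (z + τ, w) = exp (-(Real.pi : ℂ) * I * n * τ - 2 * Real.pi * I * n * z) *
    F (z, w) := fun z w => (hF1 w).2.2 z
  have F2τ : ∀ z w, F (z, w + τ) = exp (-(Real.pi : ℂ) * I * n * τ - 2 * Real.pi * I * n * w) *
    F (z, w) := fun z w => (hF2 z).2.2 w
  obtain ⟨D, hD⟩ : ∃ D, deriv T 0 = D := ⟨_, rfl⟩
  rw [hD]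
  obtain ⟨N, hN⟩ : ∃ N : ℂ → ℂ → ℂ, ∀ z₁ z₂, N z₁ z₂ =
      D * T (z₁ - z₂ - (l + k) + lam) * F (z₂ + l, z₁ - l) -
      T lam * D / T κ * T (z₁ - z₂ - (l + k) + κ) * F (z₁ - k, z₂ + k) := ⟨_, fun _ _ => rfl⟩
  have hNd : Differentiable ℂ (fun x : ℂ × ℂ => N x.1 x.2) := by
    simp only [hN]
    fun_prop
  obtain ⟨G, hG, h1, h2, h3⟩ := aux_G n τ l k T N hTd hTs hTl T1 Tτ T1' Tτ'
    (aux_N11 n τ lam κ l k D hl' hk' T F N hN T1 Tτ T1' Tτ' F11 F21 F1τ F2τ)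
    (aux_N21 n τ lam κ l k D hl' hk' T F N hN T1 Tτ T1' Tτ' F11 F21 F1τ F2τ)
    (aux_N1τ n τ lam κ l k D hl' hk' T F N hN T1 Tτ T1' Tτ' F11 F21 F1τ F2τ)
    (aux_N2τ n τ lam κ l k D hl' hk' T F N hN T1 Tτ T1' Tτ' F11 F21 F1τ F2τ)
    (aux_N0 n τ lam κ l k D hl' hk' T F N hN hκ) hNd
  refine ⟨G, hG, h1, h2, ?_⟩
  intro z w hne
  have a := h3 z w
  rw [hN] at a
  have b : G (z, w) = T (z - w - (l + k)) * G (z, w) / T (z - w - (l + k)) := by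
    field_simp
  rw [b, ← a]
  field_simp
end

section
/- Fix an integer n ≥ 1, λ, κ ∈ ℂ with sin(πλ) ≠ 0 and sin(πκ) ≠ 0, and indices i, j, k, l ∈ {0,…,n−1}; put j₀ = (n−1)/2, q = e^{πiκ}, η = e^{πiλ}, p = e^{πiκ/n}, q̂ = q − q⁻¹, η̂ = η − η⁻¹. For τ with Im τ > 0 define the Belavin matrix entry B(τ)_{ij}^{kl} = 0 if i+j ≢ k+l (mod n), and otherwise B(τ)_{ij}^{kl} = θ′_{1/2,1/2}(0, nτ)·θ_{(i−j)/n+1/2,1/2}(λ−κ, nτ)/(θ_{(i−k)/n+1/2,1/2}(−κ, nτ)·θ_{(k−j)/n+1/2,1/2}(λ, nτ)). Then, as Im τ → +∞, the conjugated entry e^{−πiτ[(i−j₀)²+(j−j₀)²−(k−j₀)²−(l−j₀)²]/n}·B(τ)_{ij}^{kl} converges to the twisted affinized Cremmer–Gervais entry (2πi/(q̂·η̂))·e^{2πiλ(i−k)/n}·p^{2(j−k)}·c_{ij}^{kl}, where c_{ij}^{kl} = (qη⁻¹ − q⁻¹η) if i=j=k=l; −η̂·q^{sgn(i−j)} if i=k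 ≠ j=l; q̂·η^{sgn(j−i)} if j=k ≠ i=l; sgn(j−i)·η̂·q̂ if i+j=k+l and min(i,j) < k < max(i,j); and 0 otherwise. (In particular Belavin's R-matrices degenerate trigonometrically to the twisted affinized Cremmer–Gervais matrices R_{CG(1/2n,0)}(λ).) -/
open Complex

/-- The theta function with characteristic:
`θ_{a,b}(z,σ) = ∑_{m∈ℤ} exp(πi(m+a)²σ + 2πi(m+a)(z+b))`. -/
noncomputable def thetaAB (a b z σ : ℂ) : ℂ :=
  ∑' m : ℤ, Complex.exp ((Real.pi : ℂ) * Complex.I * ((m : ℂ) + a) ^ 2 * σ +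
    2 * (Real.pi : ℂ) * Complex.I * ((m : ℂ) + a) * (z + b))

/-- The Belavin matrix entry `B(τ)_{ij}^{kl}`: zero unless `i+j ≡ k+l (mod n)`,
and otherwise
`θ′_{1/2,1/2}(0,nτ)·θ_{(i−j)/n+1/2,1/2}(λ−κ,nτ) /
(θ_{(i−k)/n+1/2,1/2}(−κ,nτ)·θ_{(k−j)/n+1/2,1/2}(λ,nτ))`. -/
noncomputable def belavinEntry (n : ℕ) (τ lam κ : ℂ) (i j k l : Fin n) : ℂ :=
  if ((i : ℤ) + (j : ℤ)) % (n : ℤ) = ((k : ℤ) + (l : ℤ)) % (n : ℤ) then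
    deriv (fun z => thetaAB (1 / 2) (1 / 2) z ((n : ℂ) * τ)) 0 *
      thetaAB ((((i : ℤ) - (j : ℤ) : ℤ) : ℂ) / (n : ℂ) + 1 / 2) (1 / 2)
        (lam - κ) ((n : ℂ) * τ) /
      (thetaAB ((((i : ℤ) - (k : ℤ) : ℤ) : ℂ) / (n : ℂ) + 1 / 2) (1 / 2)
          (-κ) ((n : ℂ) * τ) *
        thetaAB ((((k : ℤ) - (j : ℤ) : ℤ) : ℂ) / (n : ℂ) + 1 / 2) (1 / 2)
          lam ((n : ℂ) * τ))
  else 0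

open Filter Topology

lemma ab_term (a b z σ : ℂ) (m : ℤ) :
    Complex.exp ((Real.pi : ℂ) * Complex.I * ((m : ℂ) + a) ^ 2 * σ +
      2 * (Real.pi : ℂ) * Complex.I * ((m : ℂ) + a) * (z + b)) =
    Complex.exp ((Real.pi : ℂ) * Complex.I * a ^ 2 * σ + 2 * (Real.pi : ℂ) * Complex.I * a * (z + b)) *
      jacobiTheta₂_term m (z + b + a * σ) σ := by
  rw [jacobiTheta₂_term, ← Complex.exp_add]
  congr 1
  ring

lemma ab_hasSum (a b z : ℂ) {σ : ℂ} (hσ : 0 < σ.im) :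
    HasSum (fun m : ℤ => Complex.exp ((Real.pi : ℂ) * Complex.I * ((m : ℂ) + a) ^ 2 * σ +
      2 * (Real.pi : ℂ) * Complex.I * ((m : ℂ) + a) * (z + b)))
    (Complex.exp ((Real.pi : ℂ) * Complex.I * a ^ 2 * σ + 2 * (Real.pi : ℂ) * Complex.I * a * (z + b)) *
      jacobiTheta₂ (z + b + a * σ) σ) := by
  simp_rw [ab_term]
  exact (hasSum_jacobiTheta₂_term _ hσ).mul_left _

lemma ab_hasSum' (a b z : ℂ) {σ : ℂ} (hσ : 0 < σ.im) :
    HasSum (fun m : ℤ => (2 * (Real.pi : ℂ) * Complex.I * ((m : ℂ) + a)) *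
      Complex.exp ((Real.pi : ℂ) * Complex.I * ((m : ℂ) + a) ^ 2 * σ +
      2 * (Real.pi : ℂ) * Complex.I * ((m : ℂ) + a) * (z + b)))
    (Complex.exp ((Real.pi : ℂ) * Complex.I * a ^ 2 * σ + 2 * (Real.pi : ℂ) * Complex.I * a * (z + b)) *
      (2 * Real.pi * Complex.I * a * jacobiTheta₂ (z + b + a * σ) σ
        + jacobiTheta₂' (z + b + a * σ) σ)) := by
  have h := (((hasSum_jacobiTheta₂_term (z + b + a * σ) hσ).mul_left
    (2 * Real.pi * Complex.I * a)).add (hasSum_jacobiTheta₂'_term (z + b + a * σ) hσ)).mul_left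
    (Complex.exp ((Real.pi : ℂ) * Complex.I * a ^ 2 * σ + 2 * (Real.pi : ℂ) * Complex.I * a * (z + b)))
  refine h.congr_fun ?_ |> fun x => x
  intro m
  rw [ab_term, jacobiTheta₂'_term]
  ring

lemma ab_deriv (a b z : ℂ) {σ : ℂ} (hσ : 0 < σ.im) :
    deriv (fun z => thetaAB a b z σ) z = ∑' m : ℤ, (2 * (Real.pi : ℂ) * Complex.I * ((m : ℂ) + a)) *
      Complex.exp ((Real.pi : ℂ) * Complex.I * ((m : ℂ) + a) ^ 2 * σ +
      2 * (Real.pi : ℂ) * Complex.I * ((m : ℂ) + a) * (z + b)) := by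
  rw [(ab_hasSum' a b z hσ).tsum_eq]
  have : (fun z => thetaAB a b z σ) = fun z => 
    (Complex.exp ((Real.pi : ℂ) * Complex.I * a ^ 2 * σ + 2 * (Real.pi : ℂ) * Complex.I * a * (z + b)) *
      jacobiTheta₂ (z + b + a * σ) σ) := by
    funext z
    exact (ab_hasSum a b z hσ).tsum_eq
  rw [this]
  have h1 : HasDerivAt (fun z => (Real.pi : ℂ) * Complex.I * a ^ 2 * σ + 2 * (Real.pi : ℂ) * Complex.I * a * (z + b)) (2 * (Real.pi : ℂ) * Complex.I * a * 1) z :=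
    (((hasDerivAt_id z).add_const b).const_mul _).const_add _
  have h2 : HasDerivAt (fun z => z + b + a * σ) 1 z :=
    ((hasDerivAt_id z).add_const b).add_const _
  have h3 := (hasDerivAt_jacobiTheta₂_fst (z + b + a * σ) hσ).comp z h2
  have h4 := h1.cexp.mul h3
  refine h4.deriv.trans ?_
  simp only [Function.comp]
  ring

lemma tendsto_exp_zero (c : ℝ) (hc : 0 < c) :
    Tendsto (fun τ : ℂ => Complex.exp ((Real.pi : ℂ) * Complex.I * c * τ))
      (comap Complex.im atTop) (𝓝 0) := by
  rw [tendsto_zero_iff_norm_tendsto_zero]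
  have : (fun τ : ℂ => ‖Complex.exp ((Real.pi : ℂ) * Complex.I * c * τ)‖) =
      (fun y : ℝ => Real.exp (-((Real.pi * c) * y))) ∘ Complex.im := by
    funext τ
    simp [Complex.norm_exp]
  rw [this]
  refine Tendsto.comp ?_ tendsto_comap
  refine Real.tendsto_exp_neg_atTop_nhds_zero.comp ?_
  exact tendsto_id.const_mul_atTop (by positivity)

lemma theta_lim (N : ℝ) (hN : 0 < N) (a μ : ℝ) (hmin : ∀ m : ℤ, μ ≤ (m + a) ^ 2) (w : ℤ → ℂ)
    (hs : Summable fun m : ℤ =>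
      w m * Complex.exp ((Real.pi : ℂ) * Complex.I * ((m : ℂ) + a) ^ 2 * (N * Complex.I))) :
    Tendsto (fun τ : ℂ => Complex.exp (-((Real.pi : ℂ) * Complex.I * (N * μ : ℝ) * τ)) *
        ∑' m : ℤ, w m * Complex.exp ((Real.pi : ℂ) * Complex.I * ((m : ℂ) + a) ^ 2 * (N * τ)))
      (comap Complex.im atTop)
      (𝓝 (∑' m : ℤ, if ((m : ℝ) + a) ^ 2 = μ then w m else 0)) := by
  have key : ∀ (τ : ℂ) (m : ℤ), Complex.exp (-((Real.pi : ℂ) * Complex.I * (N * μ : ℝ) * τ)) *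
      (w m * Complex.exp ((Real.pi : ℂ) * Complex.I * ((m : ℂ) + a) ^ 2 * (N * τ))) =
      w m * Complex.exp ((Real.pi : ℂ) * Complex.I * (N * ((m + a) ^ 2 - μ) : ℝ) * τ) := by
    intro τ m
    rw [mul_left_comm, ← Complex.exp_add]
    congr 2
    push_cast
    ring
  simp_rw [← tsum_mul_left, key]
  have hs2 := (hs.mul_left
    (Complex.exp (-((Real.pi : ℂ) * Complex.I * (N * μ : ℝ) * Complex.I)))).norm
  simp_rw [key] at hs2
  refine tendsto_tsum_of_dominated_convergence hs2 ?_ ?_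
  · intro m
    split_ifs with h
    · simpa [h] using tendsto_const_nhds
    · have : 0 < N * (((m : ℝ) + a) ^ 2 - μ) :=
        mul_pos hN (sub_pos.2 (lt_of_le_of_ne (hmin m) (Ne.symm h)))
      simpa using (tendsto_exp_zero _ this).const_mul (w m)
  · have : ∀ᶠ τ : ℂ in comap Complex.im atTop, 1 ≤ τ.im :=
      tendsto_comap.eventually (eventually_ge_atTop 1)
    filter_upwards [this] with τ hτ m
    rw [norm_mul, norm_mul]
    refine mul_le_mul_of_nonneg_left ?_ (norm_nonneg _)
    rw [Complex.norm_exp, Complex.norm_exp, Real.exp_le_exp]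
    have h0 : 0 ≤ Real.pi * (N * (((m : ℝ) + a) ^ 2 - μ)) :=
      mul_nonneg Real.pi_pos.le (mul_nonneg hN.le (sub_nonneg.2 (hmin m)))
    have h1 : ∀ (c : ℝ) (σ : ℂ), ((Real.pi : ℂ) * Complex.I * (c : ℝ) * σ).re
      = -(Real.pi * c * σ.im) := by
      intro c σ
      simp
    rw [h1, h1, Complex.I_im]
    nlinarith

/-- leading exponent, divided by `n` -/
noncomputable def expo (n : ℕ) (d : ℤ) : ℝ := (|(d : ℝ)| / n - 1 / 2) ^ 2

noncomputable def Lval (n : ℕ) (d : ℤ) (z : ℂ) : ℂ :=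
  if d = 0 then -2 * Complex.sin (Real.pi * z)
  else if 0 < d then Complex.exp (2 * Real.pi * Complex.I * (d / n - 1 / 2) * (z + 1 / 2))
  else Complex.exp (2 * Real.pi * Complex.I * (d / n + 1 / 2) * (z + 1 / 2))

lemma half_min (m : ℤ) (t : ℝ) (h0 : 0 ≤ t) (h1 : t < 1) :
    (t - 1 / 2) ^ 2 ≤ (m + (t + 1 / 2)) ^ 2 ∧
    ((m + (t + 1 / 2)) ^ 2 = (t - 1 / 2) ^ 2 ↔ m = -1 ∨ (m = 0 ∧ t = 0)) := by
  have e : (m + (t + 1 / 2)) ^ 2 - (t - 1 / 2) ^ 2 = ((m : ℝ) + 1) * (m + 2 * t) := by ring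
  rcases lt_trichotomy m (-1) with h | h | h
  · have h' : (m : ℝ) ≤ -2 := by exact_mod_cast (by omega : m ≤ -2)
    have : 0 < ((m : ℝ) + 1) * (m + 2 * t) := mul_pos_of_neg_of_neg (by linarith) (by linarith)
    refine ⟨by linarith, ⟨fun h => by linarith, fun h => ?_⟩⟩
    omega
  · subst h
    refine ⟨?_, ?_⟩
    · push_cast; nlinarith
    · simp; ring
  · rcases eq_or_lt_of_le (show 0 ≤ m by omega) with h2 | h2
    · subst h2
      simp only [Int.cast_zero, zero_add] at e ⊢
      refine ⟨by nlinarith, ⟨fun h => ?_, fun h => ?_⟩⟩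
      · right; exact ⟨trivial, by linarith⟩
      · rcases h with h | h
        · omega
        · rw [h.2]; norm_num
    · have h' : (1 : ℝ) ≤ m := by exact_mod_cast h2
      have : 0 < ((m : ℝ) + 1) * (m + 2 * t) := mul_pos (by linarith) (by linarith)
      refine ⟨by linarith, ⟨fun h => by linarith, fun h => ?_⟩⟩
      omega

lemma expo_min (n : ℕ) (hn : 1 ≤ n) (d : ℤ) (hd : |d| < n) (m : ℤ) :
    expo n d ≤ (m + ((d : ℝ) / n + 1 / 2 : ℝ)) ^ 2 ∧
    ((m + ((d : ℝ) / n + 1 / 2 : ℝ)) ^ 2 = expo n d ↔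
      (m = -1 ∧ 0 ≤ d) ∨ (m = 0 ∧ d ≤ 0)) := by
  have hn0 : (0 : ℝ) < n := by exact_mod_cast hn
  have hd' : |(d : ℝ)| / n < 1 := by
    rw [div_lt_one hn0]; exact_mod_cast hd
  have hd0 : 0 ≤ |(d : ℝ)| / n := by positivity
  have hz : |(d : ℝ)| / n = 0 ↔ d = 0 := by
    simp [hn0.ne']
  rcases le_total 0 d with h | h
  · have : |(d : ℝ)| = d := abs_of_nonneg (by exact_mod_cast h)
    have := half_min m _ hd0 hd'
    rw [hz] at this
    unfold expo
    simp only [abs_of_nonneg (show (0 : ℝ) ≤ d by exact_mod_cast h)] at this ⊢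
    refine ⟨this.1, this.2.trans ?_⟩
    omega
  · have := half_min (-1 - m) _ hd0 hd'
    rw [hz] at this
    unfold expo
    have e : ((-1 - m : ℤ) + (|(d : ℝ)| / n + 1 / 2)) ^ 2 = (m + ((d : ℝ) / n + 1 / 2 : ℝ)) ^ 2 := by
      rw [abs_of_nonpos (show (d : ℝ) ≤ 0 by exact_mod_cast h)]
      push_cast; ring
    rw [e] at this
    refine ⟨this.1, this.2.trans ?_⟩
    omega

lemma exp_half_one (z : ℂ) : Complex.exp (2 * Real.pi * Complex.I * (1 / 2) * (z + 1 / 2)) =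
    Complex.I * Complex.exp (Real.pi * z * Complex.I) := by
  rw [show (2 * Real.pi * Complex.I * (1 / 2) * (z + 1 / 2) : ℂ) =
    Real.pi / 2 * Complex.I + Real.pi * z * Complex.I by ring, Complex.exp_add,
    Complex.exp_pi_div_two_mul_I]

lemma exp_half_two (z : ℂ) : Complex.exp (2 * Real.pi * Complex.I * (-(1 / 2)) * (z + 1 / 2)) =
    -Complex.I * Complex.exp (-(Real.pi * z) * Complex.I) := by
  rw [show (2 * Real.pi * Complex.I * (-(1 / 2)) * (z + 1 / 2) : ℂ) =
    -Real.pi / 2 * Complex.I + -(Real.pi * z) * Complex.I by ring, Complex.exp_add,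
    Complex.exp_neg_pi_div_two_mul_I]

lemma tsum_supp (n : ℕ) (hn : 1 ≤ n) (d : ℤ) (hd : |d| < n) (w : ℤ → ℂ) :
    (∑' m : ℤ, if ((m : ℝ) + ((d : ℝ) / n + 1 / 2 : ℝ)) ^ 2 = expo n d then w m else 0) =
    (if 0 ≤ d then w (-1) else 0) + (if d ≤ 0 then w 0 else 0) := by
  simp_rw [(expo_min n hn d hd _).2]
  rw [tsum_eq_sum (s := {-1, 0})]
  · rw [Finset.sum_pair (by norm_num)]
    simp
  · intro m hm
    simp only [Finset.mem_insert, Finset.mem_singleton, not_or] at hm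
    rw [if_neg]
    tauto

lemma theta_tendsto (n : ℕ) (hn : 1 ≤ n) (d : ℤ) (hd : |d| < n) (z : ℂ) :
    Tendsto (fun τ : ℂ => Complex.exp (-((Real.pi : ℂ) * Complex.I * ((n : ℝ) * expo n d : ℝ) * τ)) *
        thetaAB ((d : ℂ) / n + 1 / 2) (1 / 2) z (n * τ))
      (comap Complex.im atTop) (𝓝 (Lval n d z)) := by
  have hn0 : (0 : ℝ) < n := by exact_mod_cast hn
  have h := theta_lim n hn0 ((d : ℝ) / n + 1 / 2) (expo n d)
    (fun m => (expo_min n hn d hd m).1)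
    (fun m => Complex.exp (2 * Real.pi * Complex.I * (m + (d / n + 1 / 2)) * (z + 1 / 2))) ?_
  · rw [tsum_supp n hn d hd] at h
    convert h using 2
    · unfold thetaAB
      congr 2
      funext m
      rw [← Complex.exp_add]
      congr 1
      push_cast
      ring
    · unfold Lval
      rcases lt_trichotomy d 0 with h | h | h
      · rw [if_neg h.ne, if_neg h.le.not_gt, if_neg h.not_ge, if_pos h.le]
        simp
      · subst h
        simp only [if_true, le_refl]
        have := exp_half_one z
        have := exp_half_two z
        rw [show ((((-1 : ℤ) : ℂ) + (((0 : ℤ) : ℂ) / n + 1 / 2))) = -(1 / 2) by push_cast; ring,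
          show ((((0 : ℤ) : ℂ) + (((0 : ℤ) : ℂ) / n + 1 / 2))) = (1 / 2) by push_cast; ring,
          exp_half_one, exp_half_two, Complex.sin]
        ring
      · rw [if_neg h.ne', if_pos h, if_pos h.le, if_neg h.not_ge, add_zero]
        congr 2
        push_cast
        ring
  · have := (ab_hasSum ((d : ℂ) / n + 1 / 2) (1 / 2) z (σ := n * Complex.I) (by simpa using hn0)).summable
    refine this.congr fun m => ?_
    rw [← Complex.exp_add]
    congr 1
    push_cast
    ring

lemma theta_deriv_tendsto (n : ℕ) (hn : 1 ≤ n) :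
    Tendsto (fun τ : ℂ => Complex.exp (-((Real.pi : ℂ) * Complex.I * ((n : ℝ) * expo n 0 : ℝ) * τ)) *
        deriv (fun z => thetaAB (1 / 2) (1 / 2) z (n * τ)) 0)
      (comap Complex.im atTop) (𝓝 (-2 * Real.pi)) := by
  have hn0 : (0 : ℝ) < n := by exact_mod_cast hn
  have hd : |(0 : ℤ)| < n := by simpa using (by omega : 0 < n)
  have h := theta_lim n hn0 (((0 : ℤ) : ℝ) / n + 1 / 2) (expo n 0)
    (fun m => (expo_min n hn 0 hd m).1)
    (fun m => 2 * Real.pi * Complex.I * (m + 1 / 2) *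
      Complex.exp (2 * Real.pi * Complex.I * (m + 1 / 2) * (0 + 1 / 2))) ?_
  · rw [tsum_supp n hn 0 hd] at h
    have e : ((if (0 : ℤ) ≤ 0 then (2 * Real.pi * Complex.I * ((-1 : ℤ) + 1 / 2) *
      Complex.exp (2 * Real.pi * Complex.I * ((-1 : ℤ) + 1 / 2) * (0 + 1 / 2))) else 0) +
      (if (0 : ℤ) ≤ 0 then (2 * Real.pi * Complex.I * ((0 : ℤ) + 1 / 2) *
      Complex.exp (2 * Real.pi * Complex.I * ((0 : ℤ) + 1 / 2) * (0 + 1 / 2))) else 0) : ℂ) = 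
      -2 * Real.pi := by
      simp only [le_refl, if_true]
      rw [show ((((-1 : ℤ) : ℂ) + 1 / 2)) = -(1 / 2) by push_cast; ring,
          show ((((0 : ℤ) : ℂ) + 1 / 2)) = (1 / 2) by push_cast; ring,
          exp_half_one, exp_half_two]
      simp only [mul_zero, zero_mul, neg_zero, Complex.exp_zero]
      linear_combination (2 * Real.pi) * Complex.I_mul_I
    rw [e] at h
    refine h.congr' ?_
    have : ∀ᶠ τ : ℂ in comap Complex.im atTop, 1 ≤ τ.im :=
      tendsto_comap.eventually (eventually_ge_atTop 1)
    filter_upwards [this] with τ hτ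
    rw [ab_deriv _ _ _ (by simp; nlinarith)]
    congr 2
    funext m
    rw [mul_assoc, ← Complex.exp_add]
    congr 2
    push_cast
    ring
  · have := (ab_hasSum' (1 / 2) (1 / 2) 0 (σ := n * Complex.I) (by simpa using hn0)).summable
    refine this.congr fun m => ?_
    rw [mul_assoc _ (Complex.exp _) (Complex.exp _), ← Complex.exp_add]
    congr 2
    push_cast
    ring

lemma Lval_ne (n : ℕ) (d : ℤ) (z : ℂ) (hz : Complex.sin (Real.pi * z) ≠ 0) : Lval n d z ≠ 0 := by
  unfold Lval
  split_ifs
  · simpa using hz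
  · exact Complex.exp_ne_zero _
  · exact Complex.exp_ne_zero _

lemma q_hat (z : ℂ) : Complex.exp ((Real.pi : ℂ) * Complex.I * z) -
    (Complex.exp ((Real.pi : ℂ) * Complex.I * z))⁻¹ = 2 * Complex.I * Complex.sin (Real.pi * z) := by
  rw [Complex.sin, ← Complex.exp_neg,
    show -((Real.pi : ℂ) * Complex.I * z) = -(Real.pi * z) * Complex.I by ring,
    show ((Real.pi : ℂ) * Complex.I * z) = (Real.pi * z) * Complex.I by ring]
  linear_combination (Complex.exp ((Real.pi * z) * Complex.I) -
    Complex.exp (-(Real.pi * z) * Complex.I)) * Complex.I_mul_I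

lemma q_eta (lam κ : ℂ) : Complex.exp ((Real.pi : ℂ) * Complex.I * κ) *
      (Complex.exp ((Real.pi : ℂ) * Complex.I * lam))⁻¹ -
      (Complex.exp ((Real.pi : ℂ) * Complex.I * κ))⁻¹ *
      Complex.exp ((Real.pi : ℂ) * Complex.I * lam) =
    2 * Complex.I * Complex.sin (Real.pi * (κ - lam)) := by
  rw [← q_hat]
  simp only [← Complex.exp_neg, ← Complex.exp_add]
  congr 2 <;> ring

lemma coeff_zero {n : ℕ} (q η : ℂ) (i j k l : Fin n)
    (h : ¬ ((i : ℤ) + j = k + l ∧ min (i : ℤ) j ≤ k ∧ (k : ℤ) ≤ max (i : ℤ) j)) :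
    cgCoeff q η i j k l = 0 := by
  unfold cgCoeff
  simp only [Fin.ext_iff]
  rw [if_neg (by omega), if_neg (by omega), if_neg (by omega), if_neg (by omega)]

lemma limit_value (n : ℕ) (hn : 1 ≤ n) (lam κ : ℂ)
    (hlam : Complex.sin ((Real.pi : ℂ) * lam) ≠ 0)
    (hκ : Complex.sin ((Real.pi : ℂ) * κ) ≠ 0)
    (i j k l : Fin n)
    (h : ((i : ℤ) + j = k + l ∧ min (i : ℤ) j ≤ k ∧ (k : ℤ) ≤ max (i : ℤ) j)) :
    -2 * Real.pi * Lval n ((i : ℤ) - j) (lam - κ) /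
      (Lval n ((i : ℤ) - k) (-κ) * Lval n ((k : ℤ) - j) lam) =
        (2 * (Real.pi : ℂ) * Complex.I /
            ((Complex.exp ((Real.pi : ℂ) * Complex.I * κ) -
                (Complex.exp ((Real.pi : ℂ) * Complex.I * κ))⁻¹) *
              (Complex.exp ((Real.pi : ℂ) * Complex.I * lam) -
                (Complex.exp ((Real.pi : ℂ) * Complex.I * lam))⁻¹)) *
          Complex.exp (2 * (Real.pi : ℂ) * Complex.I * lam *
            (((i : ℤ) - (k : ℤ) : ℤ) : ℂ) / (n : ℂ)) *
          Complex.exp ((Real.pi : ℂ) * Complex.I * κ / (n : ℂ)) ^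
            (2 * ((j : ℤ) - (k : ℤ))) *
          cgCoeff (Complex.exp ((Real.pi : ℂ) * Complex.I * κ))
            (Complex.exp ((Real.pi : ℂ) * Complex.I * lam)) i j k l) := by
  have hn0 : (n : ℂ) ≠ 0 := by exact_mod_cast (by omega : n ≠ 0)
  have hI := Complex.I_ne_zero
  have hII := Complex.I_mul_I
  rw [← Complex.exp_int_mul]
  unfold cgCoeff
  rw [q_eta, q_hat, q_hat]
  obtain ⟨h1, h2, h3⟩ := h
  simp only [Fin.ext_iff]
  by_cases hij : (i : ℕ) = j
  · have hik : (i : ℕ) = k := by omega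
    have hil : (i : ℕ) = l := by omega
    rw [if_pos (by omega), ← hij, ← hik]
    simp only [Lval, sub_self, if_true, Int.cast_zero, mul_zero, zero_div, Complex.exp_zero,
      mul_one, zero_mul]
    rw [show (Real.pi : ℂ) * (κ - lam) = -(Real.pi * (lam - κ)) by ring, mul_neg,
      Complex.sin_neg, Complex.sin_neg]
    field_simp
    try ring
  rw [if_neg (by omega)]
  by_cases hik : (i : ℕ) = k
  · rw [if_pos (by omega), ← hik]
    rcases lt_or_gt_of_ne hij with hlt | hlt
    · rw [if_neg (by omega)]
      have hd : (i : ℤ) - j < 0 := by omega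
      simp only [Lval, if_neg hd.ne, if_neg hd.not_gt, sub_self, if_true]
      rw [show (Real.pi : ℂ) * -κ = -(Real.pi * κ) by ring, Complex.sin_neg]
      have e : Complex.exp (2 * Real.pi * Complex.I * (((i : ℤ) - j : ℤ) / n + 1 / 2) * (lam - κ + 1 / 2))
        = Complex.exp (2 * Real.pi * Complex.I * (((i : ℤ) - j : ℤ) / n + 1 / 2) * (lam + 1 / 2)) *
          Complex.exp (((2 * ((j : ℤ) - i) : ℤ) : ℂ) * (Real.pi * Complex.I * κ / n)) *
          (Complex.exp (Real.pi * Complex.I * κ))⁻¹ := by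
        rw [← Complex.exp_neg, ← Complex.exp_add, ← Complex.exp_add]
        congr 1
        push_cast
        field_simp
        ring
      rw [e]
      simp only [Int.cast_zero, mul_zero, zero_div, Complex.exp_zero]
      field_simp
      try ring
    · rw [if_pos (by omega)]
      have hd : 0 < (i : ℤ) - j := by omega
      simp only [Lval, if_neg hd.ne', if_pos hd, sub_self, if_true]
      rw [show (Real.pi : ℂ) * -κ = -(Real.pi * κ) by ring, Complex.sin_neg]
      have e : Complex.exp (2 * Real.pi * Complex.I * (((i : ℤ) - j : ℤ) / n - 1 / 2) * (lam - κ + 1 / 2))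
        = Complex.exp (2 * Real.pi * Complex.I * (((i : ℤ) - j : ℤ) / n - 1 / 2) * (lam + 1 / 2)) *
          Complex.exp (((2 * ((j : ℤ) - i) : ℤ) : ℂ) * (Real.pi * Complex.I * κ / n)) *
          (Complex.exp (Real.pi * Complex.I * κ)) := by
        rw [← Complex.exp_add, ← Complex.exp_add]
        congr 1
        push_cast
        field_simp
        ring
      rw [e]
      simp only [Int.cast_zero, mul_zero, zero_div, Complex.exp_zero]
      field_simp
      try ring
  rw [if_neg (by omega)]
  by_cases hjk : (j : ℕ) = k
  · rw [if_pos (by omega), ← hjk]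
    rcases lt_or_gt_of_ne hij with hlt | hlt
    · rw [if_pos (by omega)]
      have hd : (i : ℤ) - j < 0 := by omega
      simp only [Lval, if_neg hd.ne, if_neg hd.not_gt, sub_self, if_true]
      have e : Complex.exp (2 * Real.pi * Complex.I * (((i : ℤ) - j : ℤ) / n + 1 / 2) * (lam - κ + 1 / 2))
        = Complex.exp (2 * Real.pi * Complex.I * (((i : ℤ) - j : ℤ) / n + 1 / 2) * (-κ + 1 / 2)) *
          Complex.exp (2 * Real.pi * Complex.I * lam * ((i : ℤ) - j : ℤ) / n) *
          (Complex.exp (Real.pi * Complex.I * lam)) := by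
        rw [← Complex.exp_add, ← Complex.exp_add]
        congr 1
        push_cast
        field_simp
        ring
      rw [e]
      simp only [Int.cast_zero, mul_zero, zero_mul, zero_div, Complex.exp_zero]
      field_simp
      try ring
    · rw [if_neg (by omega)]
      have hd : 0 < (i : ℤ) - j := by omega
      simp only [Lval, if_neg hd.ne', if_pos hd, sub_self, if_true]
      have e : Complex.exp (2 * Real.pi * Complex.I * (((i : ℤ) - j : ℤ) / n - 1 / 2) * (lam - κ + 1 / 2))
        = Complex.exp (2 * Real.pi * Complex.I * (((i : ℤ) - j : ℤ) / n - 1 / 2) * (-κ + 1 / 2)) *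
          Complex.exp (2 * Real.pi * Complex.I * lam * ((i : ℤ) - j : ℤ) / n) *
          (Complex.exp (Real.pi * Complex.I * lam))⁻¹ := by
        rw [← Complex.exp_neg, ← Complex.exp_add, ← Complex.exp_add]
        congr 1
        push_cast
        field_simp
        ring
      rw [e]
      simp only [Int.cast_zero, mul_zero, zero_mul, zero_div, Complex.exp_zero]
      field_simp
      try ring
  rw [if_neg (by omega), if_pos (by omega)]
  rcases lt_or_gt_of_ne hij with hlt | hlt
  · rw [if_pos (by omega)]
    have hd1 : (i : ℤ) - j < 0 := by omega
    have hd2 : (i : ℤ) - k < 0 := by omega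
    have hd3 : (k : ℤ) - j < 0 := by omega
    simp only [Lval, if_neg hd1.ne, if_neg hd1.not_gt, if_neg hd2.ne, if_neg hd2.not_gt,
      if_neg hd3.ne, if_neg hd3.not_gt]
    have e : Complex.exp (2 * Real.pi * Complex.I * (((i : ℤ) - j : ℤ) / n + 1 / 2) * (lam - κ + 1 / 2))
        = Complex.exp (2 * Real.pi * Complex.I * (((i : ℤ) - k : ℤ) / n + 1 / 2) * (-κ + 1 / 2)) *
          Complex.exp (2 * Real.pi * Complex.I * (((k : ℤ) - j : ℤ) / n + 1 / 2) * (lam + 1 / 2)) *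
          Complex.exp (2 * Real.pi * Complex.I * lam * ((i : ℤ) - k : ℤ) / n) *
          Complex.exp (((2 * ((j : ℤ) - k) : ℤ) : ℂ) * (Real.pi * Complex.I * κ / n)) *
          (-Complex.I) := by
      rw [← Complex.exp_neg_pi_div_two_mul_I]
      simp only [← Complex.exp_add]
      congr 1
      push_cast
      field_simp
      ring
    rw [e]
    field_simp
    try ring
  · rw [if_neg (by omega)]
    have hd1 : 0 < (i : ℤ) - j := by omega
    have hd2 : 0 < (i : ℤ) - k := by omega
    have hd3 : 0 < (k : ℤ) - j := by omega
    simp only [Lval, if_neg hd1.ne', if_pos hd1, if_neg hd2.ne', if_pos hd2,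
      if_neg hd3.ne', if_pos hd3]
    have e : Complex.exp (2 * Real.pi * Complex.I * (((i : ℤ) - j : ℤ) / n - 1 / 2) * (lam - κ + 1 / 2))
        = Complex.exp (2 * Real.pi * Complex.I * (((i : ℤ) - k : ℤ) / n - 1 / 2) * (-κ + 1 / 2)) *
          Complex.exp (2 * Real.pi * Complex.I * (((k : ℤ) - j : ℤ) / n - 1 / 2) * (lam + 1 / 2)) *
          Complex.exp (2 * Real.pi * Complex.I * lam * ((i : ℤ) - k : ℤ) / n) *
          Complex.exp (((2 * ((j : ℤ) - k) : ℤ) : ℂ) * (Real.pi * Complex.I * κ / n)) *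
          Complex.exp (Real.pi / 2 * Complex.I) := by
      simp only [← Complex.exp_add]
      congr 1
      push_cast
      field_simp
      ring
    rw [e, Complex.exp_pi_div_two_mul_I]
    field_simp
    try ring

lemma n_expo (n : ℕ) (hn : 1 ≤ n) (d : ℤ) :
    (n : ℝ) * expo n d = (d : ℝ) ^ 2 / n - |(d : ℝ)| + n / 4 := by
  have hn0 : (n : ℝ) ≠ 0 := by exact_mod_cast (by omega : n ≠ 0)
  unfold expo
  rw [← sq_abs (d : ℝ)]
  field_simp
  ring

/-- The total exponent. -/
def gapG (n : ℕ) (i j k : ℤ) (s : ℤ) : ℤ :=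
  |i - k| + |k - j| - |i - j| + s * (2 * (i + j - k) - (n - 1)) + n * s ^ 2

lemma gap_eq (n : ℕ) (hn : 1 ≤ n) (i j k l s : ℤ) (hl : l = i + j - k + n * s) :
    (gapG n i j k s : ℝ) = n * expo n 0 + n * expo n (i - j) - n * expo n (i - k)
      - n * expo n (k - j) - (((i : ℝ) - ((n : ℝ) - 1) / 2) ^ 2 + ((j : ℝ) - ((n : ℝ) - 1) / 2) ^ 2 -
              ((k : ℝ) - ((n : ℝ) - 1) / 2) ^ 2 - ((l : ℝ) - ((n : ℝ) - 1) / 2) ^ 2) / n := by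
  have hn0 : (n : ℝ) ≠ 0 := by exact_mod_cast (by omega : n ≠ 0)
  simp only [n_expo n hn, hl, gapG]
  push_cast
  simp only [abs_zero]
  field_simp
  ring

lemma gap_sign (n : ℕ) (i j k l s : ℤ) (hl : l = i + j - k + n * s)
    (hi : 0 ≤ i ∧ i < n) (hj : 0 ≤ j ∧ j < n) (hk : 0 ≤ k ∧ k < n) (hl' : 0 ≤ l ∧ l < n) :
    (gapG n i j k s = 0 ∧ (i + j = k + l ∧ min i j ≤ k ∧ k ≤ max i j)) ∨
    (0 < gapG n i j k s ∧ ¬ (i + j = k + l ∧ min i j ≤ k ∧ k ≤ max i j)) := by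
  have hs1 : s < 2 := by
    by_contra! h
    nlinarith
  have hs2 : -2 < s := by
    by_contra! h
    nlinarith
  unfold gapG
  obtain rfl | rfl | rfl : s = -1 ∨ s = 0 ∨ s = 1 := by omega
  · simp only [abs, max_def, min_def]; split_ifs <;> omega
  · simp only [abs, max_def, min_def]; split_ifs <;> omega
  · simp only [abs, max_def, min_def]; split_ifs <;> omega

/-- Belavin's `R`-matrices degenerate trigonometrically to the twisted affinized
Cremmer–Gervais matrices `R_{CG(1/2n,0)}(λ)`: as `Im τ → +∞`, the conjugated
Belavin entry converges to the corresponding twisted Cremmer–Gervais entry. -/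
theorem belavin_degenerates_to_CG (n : ℕ) (hn : 1 ≤ n) (lam κ : ℂ)
    (hlam : Complex.sin ((Real.pi : ℂ) * lam) ≠ 0)
    (hκ : Complex.sin ((Real.pi : ℂ) * κ) ≠ 0)
    (i j k l : Fin n) :
    Filter.Tendsto
      (fun τ : ℂ =>
        Complex.exp (-(Real.pi : ℂ) * Complex.I * τ *
            (((i : ℂ) - ((n : ℂ) - 1) / 2) ^ 2 + ((j : ℂ) - ((n : ℂ) - 1) / 2) ^ 2 -
              ((k : ℂ) - ((n : ℂ) - 1) / 2) ^ 2 - ((l : ℂ) - ((n : ℂ) - 1) / 2) ^ 2) /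
            (n : ℂ)) *
          belavinEntry n τ lam κ i j k l)
      (Filter.comap Complex.im Filter.atTop)
      (nhds
        (2 * (Real.pi : ℂ) * Complex.I /
            ((Complex.exp ((Real.pi : ℂ) * Complex.I * κ) -
                (Complex.exp ((Real.pi : ℂ) * Complex.I * κ))⁻¹) *
              (Complex.exp ((Real.pi : ℂ) * Complex.I * lam) -
                (Complex.exp ((Real.pi : ℂ) * Complex.I * lam))⁻¹)) *
          Complex.exp (2 * (Real.pi : ℂ) * Complex.I * lam *
            (((i : ℤ) - (k : ℤ) : ℤ) : ℂ) / (n : ℂ)) *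
          Complex.exp ((Real.pi : ℂ) * Complex.I * κ / (n : ℂ)) ^
            (2 * ((j : ℤ) - (k : ℤ))) *
          cgCoeff (Complex.exp ((Real.pi : ℂ) * Complex.I * κ))
            (Complex.exp ((Real.pi : ℂ) * Complex.I * lam)) i j k l)) := by
  rcases Nat.lt_or_ge 0 n with _ | h0
  swap
  · omega
  by_cases hmod : ((i : ℤ) + (j : ℤ)) % (n : ℤ) = ((k : ℤ) + (l : ℤ)) % (n : ℤ)
  swap
  · rw [coeff_zero _ _ _ _ _ _ (fun h => hmod (by rw [h.1]))]
    simpa [belavinEntry, hmod] using tendsto_const_nhds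
  obtain ⟨s, hs⟩ := Int.ModEq.dvd (show (i : ℤ) + j ≡ k + l [ZMOD n] from hmod)
  have hl : (l : ℤ) = i + j - k + n * s := by linarith
  have hi' : 0 ≤ (i : ℤ) ∧ (i : ℤ) < n := by omega
  have hj' : 0 ≤ (j : ℤ) ∧ (j : ℤ) < n := by omega
  have hk' : 0 ≤ (k : ℤ) ∧ (k : ℤ) < n := by omega
  have hl' : 0 ≤ (l : ℤ) ∧ (l : ℤ) < n := by omega
  have hG := gap_eq n hn i j k l s hl
  have hκ' : Complex.sin ((Real.pi : ℂ) * -κ) ≠ 0 := by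
    rw [mul_neg, Complex.sin_neg]; exact neg_ne_zero.2 hκ
  have T := ((theta_deriv_tendsto n hn).mul
    (theta_tendsto n hn ((i : ℤ) - j) (by rw [abs_lt]; omega) (lam - κ))).div
    ((theta_tendsto n hn ((i : ℤ) - k) (by rw [abs_lt]; omega) (-κ)).mul
    (theta_tendsto n hn ((k : ℤ) - j) (by rw [abs_lt]; omega) lam))
    (mul_ne_zero (Lval_ne n _ _ hκ') (Lval_ne n _ _ hlam))
  have key : ∀ τ : ℂ, Complex.exp (-(Real.pi : ℂ) * Complex.I * τ *
            (((i : ℂ) - ((n : ℂ) - 1) / 2) ^ 2 + ((j : ℂ) - ((n : ℂ) - 1) / 2) ^ 2 -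
              ((k : ℂ) - ((n : ℂ) - 1) / 2) ^ 2 - ((l : ℂ) - ((n : ℂ) - 1) / 2) ^ 2) /
            (n : ℂ)) = Complex.exp ((Real.pi : ℂ) * Complex.I * (gapG n i j k s : ℝ) * τ) *
        (Complex.exp (-((Real.pi : ℂ) * Complex.I * ((n : ℝ) * expo n 0 : ℝ) * τ)) *
         Complex.exp (-((Real.pi : ℂ) * Complex.I * ((n : ℝ) * expo n ((i : ℤ) - j) : ℝ) * τ)) /
        (Complex.exp (-((Real.pi : ℂ) * Complex.I * ((n : ℝ) * expo n ((i : ℤ) - k) : ℝ) * τ)) *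
         Complex.exp (-((Real.pi : ℂ) * Complex.I * ((n : ℝ) * expo n ((k : ℤ) - j) : ℝ) * τ)))) := by
    intro τ
    simp only [← Complex.exp_add, ← Complex.exp_sub]
    congr 1
    rw [hG]
    push_cast
    ring
  have T2 : Tendsto (fun τ : ℂ => Complex.exp ((Real.pi : ℂ) * Complex.I * (gapG n i j k s : ℝ) * τ))
      (comap Complex.im atTop) (𝓝 (if gapG n i j k s = 0 then 1 else 0)) := by
    rcases gap_sign n i j k l s hl hi' hj' hk' hl' with ⟨h, _⟩ | ⟨h, _⟩
    · simpa [h] using tendsto_const_nhds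
    · rw [if_neg h.ne']
      exact tendsto_exp_zero _ (by exact_mod_cast h)
  have T3 := T2.mul T
  have fin : (if gapG n i j k s = 0 then (1 : ℂ) else 0) *
      (-2 * Real.pi * Lval n ((i : ℤ) - j) (lam - κ) /
      (Lval n ((i : ℤ) - k) (-κ) * Lval n ((k : ℤ) - j) lam)) =
        (2 * (Real.pi : ℂ) * Complex.I /
            ((Complex.exp ((Real.pi : ℂ) * Complex.I * κ) -
                (Complex.exp ((Real.pi : ℂ) * Complex.I * κ))⁻¹) *
              (Complex.exp ((Real.pi : ℂ) * Complex.I * lam) -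
                (Complex.exp ((Real.pi : ℂ) * Complex.I * lam))⁻¹)) *
          Complex.exp (2 * (Real.pi : ℂ) * Complex.I * lam *
            (((i : ℤ) - (k : ℤ) : ℤ) : ℂ) / (n : ℂ)) *
          Complex.exp ((Real.pi : ℂ) * Complex.I * κ / (n : ℂ)) ^
            (2 * ((j : ℤ) - (k : ℤ))) *
          cgCoeff (Complex.exp ((Real.pi : ℂ) * Complex.I * κ))
            (Complex.exp ((Real.pi : ℂ) * Complex.I * lam)) i j k l) := by
    rcases gap_sign n i j k l s hl hi' hj' hk' hl' with ⟨h, h2⟩ | ⟨h, h2⟩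
    · rw [if_pos h, one_mul, limit_value n hn lam κ hlam hκ i j k l h2]
    · rw [if_neg h.ne', coeff_zero _ _ _ _ _ _ h2]
      simp
  rw [← fin]
  refine T3.congr fun τ => ?_
  rw [key, belavinEntry, if_pos hmod, Pi.div_apply]
  simp only [div_eq_mul_inv, mul_inv]
  ring
end
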